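/- arXiv:1105.6027 — 5 statements merged into one kernel-verified Lean document; each statement's English description precedes it below -/
import Mathlib

section
/- Let N be a finite set and A, B, C pairwise disjoint subsets of N with A and B nonempty. Every representation of u_{⟨A,B|C⟩} by elementary imsets in E_{⟨A,B|C⟩} is σ-decomposable if and only if |A| ≤ 2 or |B| ≤ 2. -/
open Finset

/-- The semi-elementary imset `u_{⟨A,B|C⟩}` as a `ℤ`-valued function on finite sets. -/
def uim {α : Type*} [DecidableEq α] (A B C : Finset α) : Finset α → ℤ := fun S =>
  (if S = A ∪ B ∪ C then 1 else 0) + (if S = C then 1 else 0)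
    - (if S = A ∪ C then 1 else 0) - (if S = B ∪ C then 1 else 0)

/-- `θ` is a representation of `u_{⟨A,B|C⟩}` by elementary imsets from `E_{⟨A,B|C⟩}`. -/
def IsRep {α : Type*} [DecidableEq α] (A B C : Finset α) (θ : α → α → Finset α → ℕ) : Prop :=
  (∀ a b Γ, θ a b Γ ≠ 0 →
      a ∈ A ∧ b ∈ B ∧ C ⊆ Γ ∧ Γ ⊆ A ∪ B ∪ C ∧ a ∉ Γ ∧ b ∉ Γ) ∧
  ∀ S : Finset α, uim A B C S =
      ∑ a ∈ A, ∑ b ∈ B, ∑ Γ ∈ (A ∪ B ∪ C).powerset, (θ a b Γ : ℤ) * uim {a} {b} Γ S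

/-- σ-decomposability of a representation `θ` of `u_{⟨A,B|C⟩}`, defined recursively:
either `|A| = |B| = 1`, or `θ` splits (is separable) along a proper nonempty `A₀ ⊆ A`
into representations of `u_{⟨A₀,B|C⟩}` and `u_{⟨A∖A₀,B|A₀∪C⟩}` which are both
σ-decomposable, or symmetrically along some proper nonempty `B₀ ⊆ B`. -/
inductive SigmaDecomp {α : Type*} [DecidableEq α] :
    Finset α → Finset α → Finset α → (α → α → Finset α → ℕ) → Prop
  | base {A B C : Finset α} {θ : α → α → Finset α → ℕ} :
      A.card = 1 → B.card = 1 → IsRep A B C θ → SigmaDecomp A B C θ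
  | sepA {A B C : Finset α} {θ θ₁ θ₂ : α → α → Finset α → ℕ} (A₀ : Finset α) :
      A₀ ⊆ A → A₀.Nonempty → A₀ ≠ A →
      (∀ x y Z, θ x y Z = θ₁ x y Z + θ₂ x y Z) →
      IsRep A₀ B C θ₁ → IsRep (A \ A₀) B (A₀ ∪ C) θ₂ →
      SigmaDecomp A₀ B C θ₁ → SigmaDecomp (A \ A₀) B (A₀ ∪ C) θ₂ →
      SigmaDecomp A B C θ
  | sepB {A B C : Finset α} {θ θ₁ θ₂ : α → α → Finset α → ℕ} (B₀ : Finset α) :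
      B₀ ⊆ B → B₀.Nonempty → B₀ ≠ B →
      (∀ x y Z, θ x y Z = θ₁ x y Z + θ₂ x y Z) →
      IsRep A B₀ C θ₁ → IsRep A (B \ B₀) (B₀ ∪ C) θ₂ →
      SigmaDecomp A B₀ C θ₁ → SigmaDecomp A (B \ B₀) (B₀ ∪ C) θ₂ →
      SigmaDecomp A B C θ

/-- The pairing of a set function `h` with the imset `u_{⟨A,B|C⟩}`. -/
def secondDiff {α : Type*} [DecidableEq α] (h : Finset α → ℤ) (A B C : Finset α) : ℤ :=
  h (A ∪ B ∪ C) + h C - h (A ∪ C) - h (B ∪ C)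

/-- The pairing of a set function `h` with the imset encoded by the coefficients `θ`,
restricted to the triples over the ground set `U`. -/
def pairing {α : Type*} [DecidableEq α] (U : Finset α) (θ : α → α → Finset α → ℕ)
    (h : Finset α → ℤ) : ℤ :=
  ∑ p ∈ U ×ˢ U ×ˢ U.powerset, (θ p.1 p.2.1 p.2.2 : ℤ) * secondDiff h {p.1} {p.2.1} p.2.2

/-- The support of `θ` lies in `E_{⟨A,B|C⟩}`. -/
def SuppIn {α : Type*} [DecidableEq α] (A B C : Finset α) (θ : α → α → Finset α → ℕ) : Prop :=
  ∀ a b Γ, θ a b Γ ≠ 0 → a ∈ A ∧ b ∈ B ∧ C ⊆ Γ ∧ Γ ⊆ A ∪ B ∪ C ∧ a ∉ Γ ∧ b ∉ Γ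

section Basic

variable {α : Type*} [DecidableEq α] {A B C U : Finset α} {θ θ₁ θ₂ : α → α → Finset α → ℕ}

theorem secondDiff_eq_sum_uim (hU : A ∪ B ∪ C ⊆ U) (h : Finset α → ℤ) :
    secondDiff h A B C = ∑ S ∈ U.powerset, h S * uim A B C S := by
  have key : ∀ X ⊆ U, ∑ S ∈ U.powerset, h S * (if S = X then (1 : ℤ) else 0) = h X := by
    intro X hX
    simp [hX]
  simp only [uim, mul_sub, mul_add, Finset.sum_sub_distrib, Finset.sum_add_distrib]
  rw [key _ hU, key C (by grind), key _ (by grind), key _ (by grind)]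
  rfl

theorem SuppIn.pairing_eq (hs : SuppIn A B C θ) (hU : A ∪ B ∪ C ⊆ U) (h : Finset α → ℤ) :
    pairing U θ h = ∑ a ∈ A, ∑ b ∈ B, ∑ Γ ∈ (A ∪ B ∪ C).powerset,
      (θ a b Γ : ℤ) * secondDiff h {a} {b} Γ := by
  rw [pairing]
  simp only [← Finset.sum_product']
  refine (Finset.sum_subset ?_ ?_).symm
  · intro p hp
    simp only [mem_product, mem_powerset] at hp ⊢
    grind
  · intro p _ hp
    by_contra hne
    have := hs p.1 p.2.1 p.2.2 (fun h0 => hne (by simp [h0]))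
    simp only [mem_product, mem_powerset] at hp
    tauto

theorem isRep_iff_pairing (hU : A ∪ B ∪ C ⊆ U) :
    IsRep A B C θ ↔ SuppIn A B C θ ∧ ∀ h, secondDiff h A B C = pairing U θ h := by
  refine ⟨fun hr => ⟨hr.1, fun h => ?_⟩, fun hr => ⟨hr.1, fun S => ?_⟩⟩
  · rw [SuppIn.pairing_eq hr.1 hU, secondDiff_eq_sum_uim subset_rfl]
    simp only [hr.2, Finset.mul_sum]
    rw [Finset.sum_comm]
    refine Finset.sum_congr rfl fun a ha => ?_
    rw [Finset.sum_comm]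
    refine Finset.sum_congr rfl fun b hb => ?_
    rw [Finset.sum_comm]
    refine Finset.sum_congr rfl fun Γ hΓ => ?_
    rw [secondDiff_eq_sum_uim (U := A ∪ B ∪ C) (by rw [mem_powerset] at hΓ; grind),
      Finset.mul_sum]
    exact Finset.sum_congr rfl fun S _ => by ring
  · have := hr.2 (fun X => if S = X then 1 else 0)
    rw [hr.1.pairing_eq hU] at this
    exact this

theorem IsRep.suppIn (hr : IsRep A B C θ) : SuppIn A B C θ := hr.1

theorem IsRep.secondDiff_eq (hr : IsRep A B C θ) (hU : A ∪ B ∪ C ⊆ U) (h : Finset α → ℤ) :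
    secondDiff h A B C = pairing U θ h := ((isRep_iff_pairing hU).1 hr).2 h

theorem pairing_add (h : Finset α → ℤ) :
    pairing U (θ₁ + θ₂) h = pairing U θ₁ h + pairing U θ₂ h := by
  simp only [pairing, Pi.add_apply, Nat.cast_add, add_mul, Finset.sum_add_distrib]

theorem pairing_congr {h h' : Finset α → ℤ}
    (H : ∀ a b Γ, θ₁ a b Γ * secondDiff h {a} {b} Γ = θ₂ a b Γ * secondDiff h' {a} {b} Γ) :
    pairing U θ₁ h = pairing U θ₂ h' :=
  Finset.sum_congr rfl fun _ _ => H _ _ _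

theorem SuppIn.add (h₁ : SuppIn A B C θ₁) (h₂ : SuppIn A B C θ₂) :
    SuppIn A B C (θ₁ + θ₂) := by
  intro a b Γ hne
  by_cases h0 : θ₁ a b Γ = 0
  · exact h₂ a b Γ (by simpa [h0] using hne)
  · exact h₁ a b Γ h0

theorem SuppIn.mono {A' B' C' : Finset α} (h : SuppIn A' B' C' θ) (hA : A' ⊆ A) (hB : B' ⊆ B)
    (hC : C ⊆ C') (hC' : C' ⊆ A ∪ B ∪ C) : SuppIn A B C θ := by
  intro a b Γ hne
  have := h a b Γ hne
  grind

theorem IsRep.swap (hr : IsRep A B C θ) : IsRep B A C (fun x y Z => θ y x Z) := by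
  refine ⟨fun a b Γ hne => ?_, fun S => ?_⟩
  · have := hr.1 b a Γ hne
    grind
  · have huim : ∀ X Y Z : Finset α, uim X Y Z S = uim Y X Z S := by
      intro X Y Z
      simp only [uim, Finset.union_comm X Y]
      ring
    rw [huim, hr.2 S, Finset.sum_comm, Finset.union_comm A B]
    refine Finset.sum_congr rfl fun b _ => Finset.sum_congr rfl fun a _ =>
      Finset.sum_congr rfl fun Γ _ => ?_
    rw [huim]

theorem SigmaDecomp.swap (hd : SigmaDecomp A B C θ) :
    SigmaDecomp B A C (fun x y Z => θ y x Z) := by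
  induction hd with
  | base hA hB hr => exact .base hB hA hr.swap
  | sepA A₀ hsub hne hne' hadd hr₁ hr₂ _ _ ih₁ ih₂ =>
    exact .sepB A₀ hsub hne hne' (fun x y Z => hadd y x Z) hr₁.swap hr₂.swap ih₁ ih₂
  | sepB B₀ hsub hne hne' hadd hr₁ hr₂ _ _ ih₁ ih₂ =>
    exact .sepA B₀ hsub hne hne' (fun x y Z => hadd y x Z) hr₁.swap hr₂.swap ih₁ ih₂

/-- A representation whose support respects the cut `A₀` is separable along `A₀`. -/
theorem IsRep.exists_separation (hAB : Disjoint A B) (hAC : Disjoint A C)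
    (hr : IsRep A B C θ) {A₀ : Finset α} (hA₀ : A₀ ⊆ A)
    (hcut : ∀ a b Γ, θ a b Γ ≠ 0 → A₀ ⊆ Γ ∨ (a ∈ A₀ ∧ Γ ⊆ A₀ ∪ B ∪ C)) :
    ∃ θ₁ θ₂ : α → α → Finset α → ℕ, (∀ x y Z, θ x y Z = θ₁ x y Z + θ₂ x y Z) ∧
      IsRep A₀ B C θ₁ ∧ IsRep (A \ A₀) B (A₀ ∪ C) θ₂ := by
  have hAB' := Finset.disjoint_left.1 hAB
  have hAC' := Finset.disjoint_left.1 hAC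
  refine ⟨fun x y Z => if A₀ ⊆ Z then 0 else θ x y Z,
    fun x y Z => if A₀ ⊆ Z then θ x y Z else 0, fun x y Z => by by_cases h : A₀ ⊆ Z <;> simp [h],
    (isRep_iff_pairing (U := A ∪ B ∪ C) (by grind)).2 ⟨?_, fun h => ?_⟩,
    (isRep_iff_pairing (U := A ∪ B ∪ C) (by grind)).2 ⟨?_, fun h => ?_⟩⟩
  · intro a b Γ hne
    have hΓ : ¬ A₀ ⊆ Γ := fun hc => hne (if_pos hc)
    replace hne : θ a b Γ ≠ 0 := by simpa [hΓ] using hne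
    have := hr.1 a b Γ hne
    have := hcut a b Γ hne
    tauto
  · have := hr.secondDiff_eq subset_rfl (fun S => h (S ∩ (A₀ ∪ B ∪ C)))
    rw [secondDiff, show (A ∪ B ∪ C) ∩ (A₀ ∪ B ∪ C) = A₀ ∪ B ∪ C by grind,
      show (A ∪ C) ∩ (A₀ ∪ B ∪ C) = A₀ ∪ C by grind,
      show (B ∪ C) ∩ (A₀ ∪ B ∪ C) = B ∪ C by grind,
      show C ∩ (A₀ ∪ B ∪ C) = C by grind] at this
    refine this.trans (pairing_congr fun a b Γ => ?_)
    by_cases h0 : θ a b Γ = 0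
    · simp [h0]
    have h1 := hr.1 a b Γ h0
    by_cases hΓ : A₀ ⊆ Γ
    · have ha : a ∉ A₀ ∪ B ∪ C := by grind
      rw [secondDiff, show ({a} ∪ {b} ∪ Γ) ∩ (A₀ ∪ B ∪ C) = ({b} ∪ Γ) ∩ (A₀ ∪ B ∪ C) by grind,
        show ({a} ∪ Γ) ∩ (A₀ ∪ B ∪ C) = Γ ∩ (A₀ ∪ B ∪ C) by grind]
      simp [hΓ]
    · have h2 := (hcut a b Γ h0).resolve_left hΓ
      rw [secondDiff, secondDiff, if_neg hΓ,
        show ({a} ∪ {b} ∪ Γ) ∩ (A₀ ∪ B ∪ C) = {a} ∪ {b} ∪ Γ by grind,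
        show ({a} ∪ Γ) ∩ (A₀ ∪ B ∪ C) = {a} ∪ Γ by grind,
        show ({b} ∪ Γ) ∩ (A₀ ∪ B ∪ C) = {b} ∪ Γ by grind,
        show Γ ∩ (A₀ ∪ B ∪ C) = Γ by grind]
  · intro a b Γ hne
    have hΓ : A₀ ⊆ Γ := by_contra fun hc => hne (if_neg hc)
    replace hne : θ a b Γ ≠ 0 := by simpa [hΓ] using hne
    have := hr.1 a b Γ hne
    grind
  · have := hr.secondDiff_eq subset_rfl (fun S => h (A₀ ∪ S))
    rw [secondDiff] at this
    rw [secondDiff, show A \ A₀ ∪ B ∪ (A₀ ∪ C) = A₀ ∪ (A ∪ B ∪ C) by grind,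
      show A \ A₀ ∪ (A₀ ∪ C) = A₀ ∪ (A ∪ C) by grind,
      show B ∪ (A₀ ∪ C) = A₀ ∪ (B ∪ C) by grind]
    refine this.trans (pairing_congr fun a b Γ => ?_)
    by_cases h0 : θ a b Γ = 0
    · simp [h0]
    by_cases hΓ : A₀ ⊆ Γ
    · rw [secondDiff, secondDiff, if_pos hΓ,
        show A₀ ∪ ({a} ∪ {b} ∪ Γ) = {a} ∪ {b} ∪ Γ by grind,
        show A₀ ∪ ({a} ∪ Γ) = {a} ∪ Γ by grind,
        show A₀ ∪ ({b} ∪ Γ) = {b} ∪ Γ by grind,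
        show A₀ ∪ Γ = Γ by grind]
    · have h2 := (hcut a b Γ h0).resolve_left hΓ
      rw [secondDiff, show A₀ ∪ ({a} ∪ {b} ∪ Γ) = A₀ ∪ ({b} ∪ Γ) by grind,
        show A₀ ∪ ({a} ∪ Γ) = A₀ ∪ Γ by grind]
      simp [hΓ]

/-- If `h` has second difference one on `⟨A,B|C⟩`, and on elementary triples it is the indicator
of `R`, then exactly one triple in the support of a representation satisfies `R`. -/
theorem IsRep.existsUnique_of_secondDiff (hr : IsRep A B C θ) (h : Finset α → ℤ)
    (R : α → α → Finset α → Prop) (hABC : secondDiff h A B C = 1)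
    (hR : ∀ a b Γ, a ∈ A → b ∈ B → C ⊆ Γ → a ∉ Γ → b ∉ Γ → R a b Γ →
      secondDiff h {a} {b} Γ = 1)
    (hR' : ∀ a b Γ, a ∈ A → b ∈ B → C ⊆ Γ → a ∉ Γ → b ∉ Γ → ¬ R a b Γ →
      secondDiff h {a} {b} Γ = 0) :
    (∃ a b Γ, θ a b Γ ≠ 0 ∧ R a b Γ) ∧
      ∀ a b Γ a' b' Γ', θ a b Γ ≠ 0 → R a b Γ → θ a' b' Γ' ≠ 0 → R a' b' Γ' →
        a = a' ∧ b = b' ∧ Γ = Γ' := by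
  have hsum := hr.secondDiff_eq subset_rfl h
  rw [hABC, pairing] at hsum
  constructor
  · obtain ⟨⟨a, b, Γ⟩, _, hne⟩ := Finset.exists_ne_zero_of_sum_ne_zero (hsum ▸ one_ne_zero)
    have h0 : θ a b Γ ≠ 0 := fun h0 => hne (by simp [h0])
    have := hr.1 a b Γ h0
    refine ⟨a, b, Γ, h0, by_contra fun hc => hne ?_⟩
    simp only
    rw [hR' a b Γ this.1 this.2.1 this.2.2.1 this.2.2.2.2.1 this.2.2.2.2.2 hc, mul_zero]
  · intro a b Γ a' b' Γ' h0 h1 h0' h1'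
    have hs := hr.1 a b Γ h0
    have hs' := hr.1 a' b' Γ' h0'
    by_contra hne
    have hle := Finset.add_le_sum (s := (A ∪ B ∪ C) ×ˢ (A ∪ B ∪ C) ×ˢ (A ∪ B ∪ C).powerset)
      (f := fun p => (θ p.1 p.2.1 p.2.2 : ℤ) * secondDiff h {p.1} {p.2.1} p.2.2)
      (i := (a, b, Γ)) (j := (a', b', Γ')) ?_ ?_ ?_ ?_
    · rw [← hsum] at hle
      simp only at hle
      rw [hR a b Γ hs.1 hs.2.1 hs.2.2.1 hs.2.2.2.2.1 hs.2.2.2.2.2 h1,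
        hR a' b' Γ' hs'.1 hs'.2.1 hs'.2.2.1 hs'.2.2.2.2.1 hs'.2.2.2.2.2 h1'] at hle
      omega
    · rintro ⟨x, y, Z⟩ -
      simp only
      by_cases hx : θ x y Z = 0
      · simp [hx]
      have := hr.1 x y Z hx
      by_cases hc : R x y Z
      · rw [hR x y Z this.1 this.2.1 this.2.2.1 this.2.2.2.2.1 this.2.2.2.2.2 hc]
        positivity
      · rw [hR' x y Z this.1 this.2.1 this.2.2.1 this.2.2.2.2.1 this.2.2.2.2.2 hc, mul_zero]
    · simp only [mem_product, mem_powerset]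
      grind
    · simp only [mem_product, mem_powerset]
      grind
    · simpa using hne

end Basic

theorem monotone_subset_or {α : Type*} (P Q : Finset α) :
    Monotone fun S : Finset α => P ⊆ S ∨ Q ⊆ S :=
  fun _ _ h => Or.imp (fun h' => h'.trans h) (fun h' => h'.trans h)

section Crossing

variable {α : Type*} [DecidableEq α] {A B C : Finset α} {θ : α → α → Finset α → ℕ}

/-- The triples `⟨a,b|Γ⟩` with fixed `b` cross each up-set exactly once. -/
theorem IsRep.crossing_of_right (hAB : Disjoint A B) (hBC : Disjoint B C)
    (hr : IsRep A B C θ) {b : α} (hb : b ∈ B) {V : Finset α → Prop} (hV : Monotone V)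
    (hVC : ¬ V C) (hVA : V (A ∪ C)) :
    (∃ x y Γ, θ x y Γ ≠ 0 ∧ (y = b ∧ ¬ V (Γ \ B) ∧ V (({x} ∪ Γ) \ B))) ∧
      ∀ x y Γ x' y' Γ', θ x y Γ ≠ 0 → (y = b ∧ ¬ V (Γ \ B) ∧ V (({x} ∪ Γ) \ B)) →
        θ x' y' Γ' ≠ 0 → (y' = b ∧ ¬ V (Γ' \ B) ∧ V (({x'} ∪ Γ') \ B)) →
        x = x' ∧ y = y' ∧ Γ = Γ' := by
  classical
  have hAB' := Finset.disjoint_left.1 hAB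
  have hBC' := Finset.disjoint_left.1 hBC
  have hcell : ∀ x y Γ, x ∈ A → y ∈ B → ({x} ∪ {y} ∪ Γ) \ B = ({x} ∪ Γ) \ B ∧
      ({y} ∪ Γ) \ B = Γ \ B ∧ (V (Γ \ B) → V (({x} ∪ Γ) \ B)) ∧ x ≠ b := by
    intro x y Γ hx hy
    exact ⟨by grind, by grind, fun h => hV (by grind : Γ \ B ⊆ ({x} ∪ Γ) \ B) h, by grind⟩
  refine hr.existsUnique_of_secondDiff (fun S => if b ∈ S ∧ V (S \ B) then 1 else 0) _ ?_ ?_ ?_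
  · have h1 : (A ∪ B ∪ C) \ B = A ∪ C := by grind
    have h2 : (B ∪ C) \ B = C := by grind
    have h3 : b ∉ C := by grind
    have h4 : b ∉ A := by grind
    simp only [secondDiff, h1, h2]
    simp [h3, h4, hVC, hVA, hb]
  · rintro x y Γ hx hy _ hxΓ hyΓ ⟨rfl, h1, h2⟩
    obtain ⟨e1, e2, -, h3⟩ := hcell x y Γ hx hy
    simp only [secondDiff, e1, e2]
    simp [h1, h2, h3.symm, hyΓ, -singleton_union]
  · intro x y Γ hx hy _ hxΓ hyΓ hn
    obtain ⟨e1, e2, h2, h3⟩ := hcell x y Γ hx hy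
    by_cases hyb : y = b
    · subst hyb
      have : V (({x} ∪ Γ) \ B) ↔ V (Γ \ B) := by tauto
      simp only [secondDiff, e1, e2, this]
      simp [h3.symm, hyΓ]
    · simp only [secondDiff, e1, e2]
      simp [h3.symm, Ne.symm hyb]

/-- The triples `⟨a,b|Γ⟩` with `Γ` disjoint from `B` cross each up-set exactly once. -/
theorem IsRep.crossing_of_disjoint (hAB : Disjoint A B) (hBC : Disjoint B C) (hB : B.Nonempty)
    (hr : IsRep A B C θ) {V : Finset α → Prop} (hV : Monotone V)
    (hVC : ¬ V C) (hVA : V (A ∪ C)) :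
    (∃ x y Γ, θ x y Γ ≠ 0 ∧ (Disjoint Γ B ∧ ¬ V (Γ \ B) ∧ V (({x} ∪ Γ) \ B))) ∧
      ∀ x y Γ x' y' Γ', θ x y Γ ≠ 0 → (Disjoint Γ B ∧ ¬ V (Γ \ B) ∧ V (({x} ∪ Γ) \ B)) →
        θ x' y' Γ' ≠ 0 → (Disjoint Γ' B ∧ ¬ V (Γ' \ B) ∧ V (({x'} ∪ Γ') \ B)) →
        x = x' ∧ y = y' ∧ Γ = Γ' := by
  classical
  have hAB' := Finset.disjoint_left.1 hAB
  have hBC' := Finset.disjoint_left.1 hBC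
  have hcell : ∀ x y Γ, x ∈ A → y ∈ B → ¬ Disjoint ({x} ∪ {y} ∪ Γ) B ∧
      ¬ Disjoint ({y} ∪ Γ) B ∧ (Disjoint ({x} ∪ Γ) B ↔ Disjoint Γ B) ∧
      (V (Γ \ B) → V (({x} ∪ Γ) \ B)) := by
    intro x y Γ hx hy
    refine ⟨?_, ?_, ?_, fun h => hV (by grind : Γ \ B ⊆ ({x} ∪ Γ) \ B) h⟩
    · exact Finset.not_disjoint_iff.2 ⟨y, by simp, hy⟩
    · exact Finset.not_disjoint_iff.2 ⟨y, by simp, hy⟩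
    · simp [hAB' hx]
  refine hr.existsUnique_of_secondDiff
    (fun S => if Disjoint S B ∧ V (S \ B) then -1 else 0) _ ?_ ?_ ?_
  · have h1 : (A ∪ C) \ B = A ∪ C := by grind
    have h2 : C \ B = C := by grind
    simp only [secondDiff, h1, h2]
    simp [hVC, hVA, hAB, hBC.symm, hB.ne_empty]
  · rintro x y Γ hx hy _ hxΓ hyΓ ⟨h0, h1, h2⟩
    obtain ⟨e1, e2, e3, -⟩ := hcell x y Γ hx hy
    simp only [secondDiff, e1, e2, e3]
    simp [h0, h1, h2, -singleton_union]
  · intro x y Γ hx hy _ hxΓ hyΓ hn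
    obtain ⟨e1, e2, e3, h2⟩ := hcell x y Γ hx hy
    simp only [secondDiff, e1, e2, e3]
    by_cases h0 : Disjoint Γ B
    · have : V (({x} ∪ Γ) \ B) ↔ V (Γ \ B) := by tauto
      simp [this, -singleton_union]
    · simp [h0]

theorem SuppIn.not_subset_sdiff (hAB : Disjoint A B) (hs : SuppIn A B C θ) {x y : α}
    {Γ : Finset α} (h : θ x y Γ ≠ 0) : ¬ ({x} ∪ Γ) \ B ⊆ Γ \ B := by
  have hs' := hs x y Γ h
  have hx : x ∈ ({x} ∪ Γ) \ B := by simp [Finset.disjoint_left.1 hAB hs'.1]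
  exact fun hc => hs'.2.2.2.2.1 (mem_sdiff.1 (hc hx)).1

theorem SuppIn.not_subset_base (hAB : Disjoint A B) (hAC : Disjoint A C) (hs : SuppIn A B C θ)
    {x y : α} {Γ : Finset α} (h : θ x y Γ ≠ 0) : ¬ ({x} ∪ Γ) \ B ⊆ C := by
  have hs' := hs x y Γ h
  have hx : x ∈ ({x} ∪ Γ) \ B := by simp [Finset.disjoint_left.1 hAB hs'.1]
  exact fun hc => Finset.disjoint_left.1 hAC hs'.1 (hc hx)

theorem SuppIn.sdiff_subset (hs : SuppIn A B C θ) {x y : α} {Γ : Finset α} (h : θ x y Γ ≠ 0) :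
    ({x} ∪ Γ) \ B ⊆ A ∪ C := by
  have hs' := hs x y Γ h
  intro z hz
  have := @hs'.2.2.2.1 z
  grind

theorem IsRep.comparable_of_right (hAB : Disjoint A B) (hAC : Disjoint A C) (hBC : Disjoint B C)
    (hr : IsRep A B C θ) {b x x' : α} {Γ Γ' : Finset α} (h : θ x b Γ ≠ 0) (h' : θ x' b Γ' ≠ 0) :
    ({x} ∪ Γ) \ B ⊆ Γ' \ B ∨ ({x'} ∪ Γ') \ B ⊆ Γ \ B ∨ (x = x' ∧ Γ = Γ') := by
  by_contra! hn
  have hs := hr.suppIn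
  have := (hr.crossing_of_right hAB hBC (hs x b Γ h).2.1
    (monotone_subset_or (({x} ∪ Γ) \ B) (({x'} ∪ Γ') \ B))
    (not_or.2 ⟨hs.not_subset_base hAB hAC h, hs.not_subset_base hAB hAC h'⟩)
    (.inl (hs.sdiff_subset h))).2
    x b Γ x' b Γ' h ⟨rfl, not_or.2 ⟨hs.not_subset_sdiff hAB h, hn.2.1⟩, .inl subset_rfl⟩
    h' ⟨rfl, not_or.2 ⟨hn.1, hs.not_subset_sdiff hAB h'⟩, .inr subset_rfl⟩
  tauto

theorem IsRep.comparable_of_disjoint (hAB : Disjoint A B) (hAC : Disjoint A C)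
    (hBC : Disjoint B C) (hr : IsRep A B C θ) {b b' x x' : α} {Γ Γ' : Finset α}
    (h : θ x b Γ ≠ 0) (h' : θ x' b' Γ' ≠ 0) (hΓ : Disjoint Γ B) (hΓ' : Disjoint Γ' B) :
    ({x} ∪ Γ) \ B ⊆ Γ' \ B ∨ ({x'} ∪ Γ') \ B ⊆ Γ \ B ∨ (x = x' ∧ b = b' ∧ Γ = Γ') := by
  by_contra! hn
  have hs := hr.suppIn
  have := (hr.crossing_of_disjoint hAB hBC ⟨b, (hs x b Γ h).2.1⟩
    (monotone_subset_or (({x} ∪ Γ) \ B) (({x'} ∪ Γ') \ B))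
    (not_or.2 ⟨hs.not_subset_base hAB hAC h, hs.not_subset_base hAB hAC h'⟩)
    (.inl (hs.sdiff_subset h))).2
    x b Γ x' b' Γ' h ⟨hΓ, not_or.2 ⟨hs.not_subset_sdiff hAB h, hn.2.1⟩, .inl subset_rfl⟩
    h' ⟨hΓ', not_or.2 ⟨hn.1, hs.not_subset_sdiff hAB h'⟩, .inr subset_rfl⟩
  tauto

/-- Among the triples `⟨x,b|Γ⟩` in the support with `Γ` disjoint from `B` there is a least one. -/
theorem IsRep.exists_least (hAB : Disjoint A B) (hAC : Disjoint A C) (hBC : Disjoint B C)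
    (hr : IsRep A B C θ) {b : α} (hb : ∃ x Γ, θ x b Γ ≠ 0 ∧ Disjoint Γ B) :
    ∃ x X, θ x b X ≠ 0 ∧ Disjoint X B ∧ ∀ y Γ, θ y b Γ ≠ 0 → Disjoint Γ B → X ⊆ Γ := by
  obtain ⟨x, X, h⟩ := hb
  obtain ⟨⟨x, X⟩, ⟨hx, hX⟩, hmin⟩ := exists_minimalFor_of_wellFoundedLT
    (fun p : α × Finset α => θ p.1 b p.2 ≠ 0 ∧ Disjoint p.2 B) (fun p => p.2.card) ⟨(x, X), h⟩
  refine ⟨x, X, hx, hX, fun y Γ hy hΓ => ?_⟩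
  rcases hr.comparable_of_right hAB hAC hBC hx hy with h | h | ⟨-, h⟩
  · rw [sdiff_eq_self_of_disjoint hΓ] at h
    exact fun z hz => h (mem_sdiff.2 ⟨by simp [hz], Finset.disjoint_left.1 hX hz⟩)
  · rw [sdiff_eq_self_of_disjoint hX] at h
    have hsub : Γ ⊆ X := fun z hz => h (mem_sdiff.2 ⟨by simp [hz], Finset.disjoint_left.1 hΓ hz⟩)
    exact (Finset.eq_of_subset_of_card_le hsub
      (@hmin (y, Γ) ⟨hy, hΓ⟩ (card_le_card hsub))).ge
  · exact h.le

/-- If all triples with conditioning set disjoint from `B = {b, b'}` are of the form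
`⟨x,b'|Γ⟩`, then the support respects the cut `{b'}` of `B`. -/
theorem IsRep.cut_right_of_forall (hAB : Disjoint A B) (hAC : Disjoint A C) (hBC : Disjoint B C)
    (hr : IsRep A B C θ) {b b' : α} (hB : B = {b, b'})
    (hb : ∀ x Γ, θ x b Γ ≠ 0 → ¬ Disjoint Γ B) {x y : α} {Γ : Finset α} (h : θ x y Γ ≠ 0) :
    {b'} ⊆ Γ ∨ (y ∈ ({b'} : Finset α) ∧ Γ ⊆ {b'} ∪ A ∪ C) := by
  have hs := hr.suppIn
  have hxy := hs x y Γ h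
  have hyB : y = b ∨ y = b' := by simpa [hB] using hxy.2.1
  by_cases hΓ : Disjoint Γ B
  · have hy : y = b' := hyB.resolve_left fun hy => hb x Γ (hy ▸ h) hΓ
    refine .inr ⟨by simp [hy], fun z hz => ?_⟩
    have := hxy.2.2.2.1 hz
    have := Finset.disjoint_left.1 hΓ hz
    grind
  · have hy : y ≠ b' := by
      rintro rfl
      have hV := monotone_subset_or (({x} ∪ Γ) \ B) (({x} ∪ Γ) \ B)
      have hVC := not_or.2 ⟨hs.not_subset_base hAB hAC h, hs.not_subset_base hAB hAC h⟩
      have hVA := Or.inl (b := ({x} ∪ Γ) \ B ⊆ A ∪ C) (hs.sdiff_subset h)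
      obtain ⟨u, v, Δ, huv, hΔ, hc⟩ :=
        (hr.crossing_of_disjoint hAB hBC ⟨y, hxy.2.1⟩ hV hVC hVA).1
      have hv : v = y := by
        have hvB := (hs u v Δ huv).2.1
        rw [hB] at hvB
        rcases mem_insert.1 hvB with rfl | hv
        · exact absurd hΔ (hb u Δ huv)
        · exact mem_singleton.1 hv
      have := (hr.crossing_of_right hAB hBC hxy.2.1 hV hVC hVA).2 u v Δ x y Γ huv ⟨hv, hc⟩ h
        ⟨rfl, not_or.2 ⟨hs.not_subset_sdiff hAB h, hs.not_subset_sdiff hAB h⟩, .inl subset_rfl⟩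
      exact hΓ (this.2.2 ▸ hΔ)
    obtain ⟨z, hzΓ, hzB⟩ := Finset.not_disjoint_iff.1 hΓ
    have hy' := hyB.resolve_right hy
    left
    rw [hB] at hzB
    grind

/-- The conditioning set of the least triple `⟨x',b'|X'⟩` gives a cut of `A` respected by the
support, if it lies above some triple `⟨x,b|X⟩`. -/
theorem IsRep.cut_left_of_least (hAB : Disjoint A B) (hAC : Disjoint A C) (hBC : Disjoint B C)
    (hr : IsRep A B C θ) {b b' : α} (hB : B = {b, b'}) (hbb' : b ≠ b') {a a' : α}
    {X X' : Finset α} (h : θ a b X ≠ 0) (h' : θ a' b' X' ≠ 0)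
    (hX' : Disjoint X' B) (hmin : ∀ y Γ, θ y b' Γ ≠ 0 → Disjoint Γ B → X' ⊆ Γ)
    (hlt : ({a} ∪ X) \ B ⊆ X' \ B) {x y : α} {Γ : Finset α} (hxy : θ x y Γ ≠ 0) :
    X' ⊆ Γ \ B ∨ ({x} ∪ Γ) \ B ⊆ X' := by
  have hs := hr.suppIn
  have hX'B := sdiff_eq_self_of_disjoint hX'
  have hsub : X' ⊆ ({a'} ∪ X') \ B := by
    rw [← hX'B]
    exact Finset.sdiff_subset_sdiff (by rw [hX'B]; exact subset_union_right) subset_rfl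
  have hs' := hs x y Γ hxy
  by_cases hΓ : Disjoint Γ B
  · rcases hr.comparable_of_disjoint hAB hAC hBC h' hxy hX' hΓ with h1 | h1 | ⟨-, -, rfl⟩
    · exact .inl (hsub.trans h1)
    · exact .inr (hX'B ▸ h1)
    · exact .inl hX'B.ge
  by_cases hy : y = b'
  · subst hy
    rcases hr.comparable_of_right hAB hAC hBC h' hxy with h1 | h1 | ⟨-, rfl⟩
    · exact .inl (hsub.trans h1)
    · exact .inr (hX'B ▸ h1)
    · exact .inl hX'B.ge
  have hyb : y = b := by
    have := hs'.2.1
    rw [hB] at this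
    grind
  subst hyb
  by_contra! hn
  have hX'C : ¬ X' ⊆ C := fun hc =>
    hs.not_subset_base hAB hAC h (hlt.trans (by rwa [hX'B]))
  have hV := monotone_subset_or X' (({x} ∪ Γ) \ B)
  have hVC := not_or.2 ⟨hX'C, hs.not_subset_base hAB hAC hxy⟩
  have hVA := Or.inr (a := X' ⊆ A ∪ C) (hs.sdiff_subset hxy)
  obtain ⟨u, v, Δ, huv, hΔ, hc⟩ :=
    (hr.crossing_of_disjoint hAB hBC ⟨y, hs'.2.1⟩ hV hVC hVA).1
  have hv : v ≠ b' := by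
    rintro rfl
    refine hc.1 (.inl ?_)
    rw [sdiff_eq_self_of_disjoint hΔ]
    exact hmin u Δ huv hΔ
  have hvy : v = y := by
    have := (hs u v Δ huv).2.1
    rw [hB] at this
    grind
  have := (hr.crossing_of_right hAB hBC hs'.2.1 hV hVC hVA).2 u v Δ x y Γ huv ⟨hvy, hc⟩ hxy
    ⟨rfl, not_or.2 ⟨hn.1, hs.not_subset_sdiff hAB hxy⟩, .inr subset_rfl⟩
  exact hΓ (this.2.2 ▸ hΔ)

theorem IsRep.exists_cut_left (hAB : Disjoint A B) (hAC : Disjoint A C) (hBC : Disjoint B C)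
    (hr : IsRep A B C θ) {b b' : α} (hB : B = {b, b'}) (hbb' : b ≠ b') {a a' : α}
    {X X' : Finset α} (h : θ a b X ≠ 0) (h' : θ a' b' X' ≠ 0)
    (hX' : Disjoint X' B) (hmin : ∀ y Γ, θ y b' Γ ≠ 0 → Disjoint Γ B → X' ⊆ Γ)
    (hlt : ({a} ∪ X) \ B ⊆ X' \ B) :
    ∃ A₀ ⊆ A, A₀.Nonempty ∧ A₀ ≠ A ∧
      ∀ x y Γ, θ x y Γ ≠ 0 → A₀ ⊆ Γ ∨ (x ∈ A₀ ∧ Γ ⊆ A₀ ∪ B ∪ C) := by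
  have hs := hr.1 a b X h
  have hs' := hr.1 a' b' X' h'
  have hAB' := Finset.disjoint_left.1 hAB
  have hAC' := Finset.disjoint_left.1 hAC
  have hX'B := Finset.disjoint_left.1 hX'
  have haX' : a ∈ X' := (mem_sdiff.1 (hlt (mem_sdiff.2 ⟨by simp, hAB' hs.1⟩))).1
  refine ⟨X' \ C, ?_, ⟨a, mem_sdiff.2 ⟨haX', hAC' hs.1⟩⟩, ?_, fun x y Γ hxy => ?_⟩
  · intro z hz
    have := @hs'.2.2.2.1 z
    grind
  · rintro rfl
    exact hs'.2.2.2.2.1 (mem_sdiff.1 hs'.1).1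
  · have hx := (hr.1 x y Γ hxy).1
    have hxB := hAB' hx
    have hxC := hAC' hx
    rcases hr.cut_left_of_least hAB hAC hBC hB hbb' h h' hX' hmin hlt hxy with h1 | h1
    · exact .inl fun z hz => (mem_sdiff.1 (h1 (mem_sdiff.1 hz).1)).1
    · refine .inr ⟨mem_sdiff.2 ⟨h1 (mem_sdiff.2 ⟨by simp, hxB⟩), hxC⟩, fun z hz => ?_⟩
      have := @h1 z
      grind

end Crossing

theorem IsRep.sigmaDecomp_of_card_le_two {α : Type*} [DecidableEq α] (n : ℕ) :
    ∀ {A B C : Finset α} {θ : α → α → Finset α → ℕ}, A.card + B.card ≤ n →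
      Disjoint A B → Disjoint A C → Disjoint B C → A.Nonempty → B.Nonempty → B.card ≤ 2 →
      IsRep A B C θ → SigmaDecomp A B C θ := by
  induction n with
  | zero =>
    intro A B C θ hn _ _ _ hA
    have := hA.card_pos
    omega
  | succ n ih =>
    intro A B C θ hn hAB hAC hBC hA hB hB2 hr
    have hcutA : (∃ A₀ ⊆ A, A₀.Nonempty ∧ A₀ ≠ A ∧
        ∀ x y Γ, θ x y Γ ≠ 0 → A₀ ⊆ Γ ∨ (x ∈ A₀ ∧ Γ ⊆ A₀ ∪ B ∪ C)) → SigmaDecomp A B C θ := by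
      rintro ⟨A₀, hsub, hne, hneA, hcut⟩
      obtain ⟨θ₁, θ₂, hadd, hr₁, hr₂⟩ := hr.exists_separation hAB hAC hsub hcut
      have hc := card_sdiff_add_card_eq_card hsub
      have hlt := card_lt_card (hsub.ssubset_of_ne hneA)
      have hpos := hne.card_pos
      have hdisj : Disjoint (A \ A₀) (A₀ ∪ C) :=
        disjoint_union_right.2 ⟨sdiff_disjoint, hAC.mono_left sdiff_subset⟩
      have hdisj' : Disjoint B (A₀ ∪ C) :=
        disjoint_union_right.2 ⟨(hAB.mono_left hsub).symm, hBC⟩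
      exact .sepA A₀ hsub hne hneA hadd hr₁ hr₂
        (ih (by omega) (hAB.mono_left hsub) (hAC.mono_left hsub) hBC hne hB hB2 hr₁)
        (ih (by omega) (hAB.mono_left sdiff_subset) hdisj hdisj'
          (card_pos.1 (by omega)) hB hB2 hr₂)
    have hcutB : (∃ B₀ ⊆ B, B₀.Nonempty ∧ B₀ ≠ B ∧
        ∀ x y Γ, θ x y Γ ≠ 0 → B₀ ⊆ Γ ∨ (y ∈ B₀ ∧ Γ ⊆ B₀ ∪ A ∪ C)) → SigmaDecomp A B C θ := by
      rintro ⟨B₀, hsub, hne, hneB, hcut⟩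
      obtain ⟨θ₁, θ₂, hadd, hr₁, hr₂⟩ := hr.swap.exists_separation hAB.symm hBC hsub
        (fun x y Γ h => hcut y x Γ h)
      have hc := card_sdiff_add_card_eq_card hsub
      have hlt := card_lt_card (hsub.ssubset_of_ne hneB)
      have hpos := hne.card_pos
      have hdisj : Disjoint (B \ B₀) (B₀ ∪ C) :=
        disjoint_union_right.2 ⟨sdiff_disjoint, hBC.mono_left sdiff_subset⟩
      have hdisj' : Disjoint A (B₀ ∪ C) :=
        disjoint_union_right.2 ⟨hAB.mono_right hsub, hAC⟩
      exact .sepB B₀ hsub hne hneB (fun x y Z => hadd y x Z) hr₁.swap hr₂.swap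
        (ih (by omega) (hAB.mono_right hsub) hAC (hBC.mono_left hsub) hA hne (by omega) hr₁.swap)
        (ih (by omega) (hAB.mono_right sdiff_subset) hdisj' hdisj hA
          (card_pos.1 (by omega)) (by omega) hr₂.swap)
    have hBpos := hB.card_pos
    rcases (by omega : B.card = 1 ∨ B.card = 2) with hB1 | hB2
    · by_cases hA1 : A.card = 1
      · exact .base hA1 hB1 hr
      apply hcutA
      obtain ⟨b, rfl⟩ := card_eq_one.1 hB1
      have hV : Monotone fun S : Finset α => ¬ S ⊆ C := fun S T h hS hT => hS (h.trans hT)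
      obtain ⟨a, b', X, h, rfl, hX, -⟩ := (hr.crossing_of_right hAB hBC (mem_singleton_self b) hV
        (not_not.2 subset_rfl) (fun hc => by
          obtain ⟨a, ha⟩ := hA
          exact Finset.disjoint_left.1 hAC ha (hc (mem_union_left _ ha)))).1
      have hs := hr.1 a b' X h
      refine ⟨{a}, by simpa using hs.1, singleton_nonempty a, fun hc => hA1 (by simp [← hc]),
        fun x y Γ hxy => ?_⟩
      have hs' := hr.1 x y Γ hxy
      obtain rfl := mem_singleton.1 hs'.2.1
      have haB := Finset.disjoint_left.1 hAB hs.1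
      rcases hr.comparable_of_right hAB hAC hBC h hxy with h1 | h1 | ⟨rfl, rfl⟩
      · exact .inl (singleton_subset_iff.2 (mem_sdiff.1 (h1 (mem_sdiff.2 ⟨by simp, haB⟩))).1)
      · exact absurd (h1.trans (not_not.1 hX)) (hr.suppIn.not_subset_base hAB hAC hxy)
      · refine .inr ⟨mem_singleton_self a, fun z hz => ?_⟩
        have := @not_not.1 hX z
        grind
    · obtain ⟨b, b', hbb', hBeq⟩ := card_eq_two.1 hB2
      have hBeq' : B = {b', b} := by rw [hBeq, pair_comm]
      have hne : ∀ c, ({c} : Finset α) ≠ B := fun c hc => by simp [← hc] at hB2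
      by_cases hb : ∃ x Γ, θ x b Γ ≠ 0 ∧ Disjoint Γ B
      · by_cases hb' : ∃ x Γ, θ x b' Γ ≠ 0 ∧ Disjoint Γ B
        · obtain ⟨a, X, h, hX, hmin⟩ := hr.exists_least hAB hAC hBC hb
          obtain ⟨a', X', h', hX', hmin'⟩ := hr.exists_least hAB hAC hBC hb'
          apply hcutA
          rcases hr.comparable_of_disjoint hAB hAC hBC h h' hX hX' with h1 | h1 | ⟨-, h1, -⟩
          · exact hr.exists_cut_left hAB hAC hBC hBeq hbb' h h' hX' hmin' h1
          · exact hr.exists_cut_left hAB hAC hBC hBeq' hbb'.symm h' h hX hmin h1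
          · exact absurd h1 hbb'
        · exact hcutB ⟨{b}, by simp [hBeq], singleton_nonempty b, hne b, fun x y Γ hxy =>
            hr.cut_right_of_forall hAB hAC hBC hBeq' (by simpa using hb') hxy⟩
      · exact hcutB ⟨{b'}, by simp [hBeq], singleton_nonempty b', hne b', fun x y Γ hxy =>
          hr.cut_right_of_forall hAB hAC hBC hBeq (by simpa using hb) hxy⟩

section Pinwheel

variable {α : Type*} [DecidableEq α] {A B C : Finset α} {θ : α → α → Finset α → ℕ}

theorem SigmaDecomp.exists_cut (hd : SigmaDecomp A B C θ) (hA : A.card ≠ 1) :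
    (∃ A₀ ⊆ A, A₀.Nonempty ∧ A₀ ≠ A ∧
      ∀ x y Γ, θ x y Γ ≠ 0 → A₀ ⊆ Γ ∨ (x ∈ A₀ ∧ Γ ⊆ A₀ ∪ B ∪ C)) ∨
    (∃ B₀ ⊆ B, B₀.Nonempty ∧ B₀ ≠ B ∧
      ∀ x y Γ, θ x y Γ ≠ 0 → B₀ ⊆ Γ ∨ (y ∈ B₀ ∧ Γ ⊆ A ∪ B₀ ∪ C)) := by
  cases hd with
  | base h => exact absurd h hA
  | @sepA _ _ _ _ θ₁ θ₂ A₀ hsub hne hneA hadd hr₁ hr₂ _ _ =>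
    refine .inl ⟨A₀, hsub, hne, hneA, fun x y Γ h => ?_⟩
    by_cases h₁ : θ₁ x y Γ = 0
    · have h₂ : θ₂ x y Γ ≠ 0 := fun h₂ => h (by rw [hadd, h₁, h₂])
      exact .inl (subset_union_left.trans (hr₂.1 x y Γ h₂).2.2.1)
    · have := hr₁.1 x y Γ h₁
      exact .inr ⟨this.1, this.2.2.2.1⟩
  | @sepB _ _ _ _ θ₁ θ₂ B₀ hsub hne hneB hadd hr₁ hr₂ _ _ =>
    refine .inr ⟨B₀, hsub, hne, hneB, fun x y Γ h => ?_⟩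
    by_cases h₁ : θ₁ x y Γ = 0
    · have h₂ : θ₂ x y Γ ≠ 0 := fun h₂ => h (by rw [hadd, h₁, h₂])
      exact .inl (subset_union_left.trans (hr₂.1 x y Γ h₂).2.2.1)
    · have := hr₁.1 x y Γ h₁
      exact .inr ⟨this.2.1, this.2.2.2.1⟩

/-- The coefficients of the single elementary imset `u_{⟨a,b|Γ⟩}`. -/
def elementary (a b : α) (Γ : Finset α) : α → α → Finset α → ℕ :=
  fun x y Z => if x = a ∧ y = b ∧ Z = Γ then 1 else 0

theorem isRep_elementary {a b : α} {Γ : Finset α} (ha : a ∉ Γ) (hb : b ∉ Γ) :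
    IsRep {a} {b} Γ (elementary a b Γ) := by
  refine (isRep_iff_pairing subset_rfl).2 ⟨fun x y Z h => ?_, fun h => ?_⟩
  · obtain ⟨rfl, rfl, rfl⟩ : x = a ∧ y = b ∧ Z = Γ := by
      by_contra hc
      exact h (if_neg hc)
    exact ⟨mem_singleton_self _, mem_singleton_self _, subset_rfl, subset_union_right, ha, hb⟩
  · rw [pairing, Finset.sum_eq_single (a, b, Γ)]
    · simp [elementary]
    · rintro ⟨x, y, Z⟩ - hne
      have : ¬ (x = a ∧ y = b ∧ Z = Γ) := by simpa using hne
      simp [elementary, this]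
    · intro hn
      simp only [mem_product, mem_powerset] at hn
      grind

theorem IsRep.glue {A₀ A₁ : Finset α} {θ₁ θ₂ : α → α → Finset α → ℕ}
    (h₁ : IsRep A₀ B C θ₁) (h₂ : IsRep A₁ B (A₀ ∪ C) θ₂) :
    IsRep (A₀ ∪ A₁) B C (θ₁ + θ₂) := by
  refine (isRep_iff_pairing subset_rfl).2 ⟨.add (h₁.suppIn.mono ?_ ?_ ?_ ?_)
    (h₂.suppIn.mono ?_ ?_ ?_ ?_), fun h => ?_⟩
  any_goals grind
  rw [pairing_add, ← h₁.secondDiff_eq (by grind), ← h₂.secondDiff_eq (by grind)]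
  simp only [secondDiff, union_comm, union_left_comm]
  ring

theorem exists_isRep (hAB : Disjoint A B) (hAC : Disjoint A C) (hBC : Disjoint B C) :
    ∃ θ, IsRep A B C θ := by
  have hzero : ∀ B C : Finset α, IsRep ∅ B C 0 := fun B C => ⟨by simp, by simp [uim]⟩
  have hsingle : ∀ (b : α) (A C : Finset α), b ∉ A → b ∉ C → Disjoint A C →
      ∃ θ, IsRep A {b} C θ := by
    intro b A
    induction A using Finset.induction_on with
    | empty => exact fun C _ _ _ => ⟨0, hzero _ _⟩
    | insert a A ha ih =>
      intro C hA hC hd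
      rw [disjoint_insert_left] at hd
      obtain ⟨θ, hθ⟩ := ih ({a} ∪ C) (by grind) (by grind)
        (disjoint_union_right.2 ⟨by simpa using ha, hd.2⟩)
      exact ⟨_, insert_eq a A ▸ (isRep_elementary hd.1 hC).glue hθ⟩
  suffices ∃ θ, IsRep B A C θ from this.imp' _ fun _ h => h.swap
  induction B using Finset.induction_on generalizing C with
  | empty => exact ⟨0, hzero _ _⟩
  | insert b B hb ih =>
    rw [disjoint_insert_left] at hBC
    rw [disjoint_insert_right] at hAB
    obtain ⟨θ₁, hθ₁⟩ := hsingle b A C hAB.1 hBC.1 hAC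
    obtain ⟨θ₂, hθ₂⟩ := ih (C := {b} ∪ C) hAB.2
      (disjoint_union_right.2 ⟨by simpa using hAB.1, hAC⟩)
      (disjoint_union_right.2 ⟨by simpa using hb, hBC.2⟩)
    exact ⟨_, insert_eq b B ▸ hθ₁.swap.glue hθ₂⟩

theorem IsRep.exists_ne_zero (hr : IsRep A B C θ) (hAC : Disjoint A C) (hBC : Disjoint B C)
    (hA : A.Nonempty) (hB : B.Nonempty) : ∃ x y Γ, θ x y Γ ≠ 0 := by
  by_contra! hn
  have h := hr.2 C
  obtain ⟨a, ha⟩ := hA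
  obtain ⟨b, hb⟩ := hB
  have haC := Finset.disjoint_left.1 hAC ha
  have hbC := Finset.disjoint_left.1 hBC hb
  have h1 : C ≠ A ∪ B ∪ C := fun h => haC (by rw [h]; simp [ha])
  have h2 : C ≠ A ∪ C := fun h => haC (by rw [h]; simp [ha])
  have h3 : C ≠ B ∪ C := fun h => hbC (by rw [h]; simp [hb])
  simp only [uim, if_neg h1, if_neg h2, if_neg h3, hn] at h
  simp at h

/-- The pinwheel tiling of a three by three grid. -/
theorem secondDiff_pinwheel (h : Finset α → ℤ) (P M P' Q L Q' C : Finset α) :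
    secondDiff h (P ∪ M ∪ P') (Q ∪ L ∪ Q') C =
      secondDiff h M Q C + secondDiff h P' L (P ∪ M ∪ C) +
      secondDiff h M Q' (P ∪ P' ∪ Q ∪ L ∪ C) + secondDiff h P L (Q ∪ Q' ∪ C) +
      secondDiff h M L (P ∪ Q ∪ C) + secondDiff h P Q (M ∪ C) +
      secondDiff h P' Q (P ∪ M ∪ L ∪ C) + secondDiff h P' Q' (P ∪ Q ∪ L ∪ C) +
      secondDiff h P Q' (Q ∪ C) := by
  simp only [secondDiff, union_comm, union_left_comm]
  ring

theorem exists_isRep_pinwheel {P M P' Q L Q' : Finset α}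
    (hAB : Disjoint (P ∪ M ∪ P') (Q ∪ L ∪ Q')) (hAC : Disjoint (P ∪ M ∪ P') C)
    (hBC : Disjoint (Q ∪ L ∪ Q') C) (hPM : Disjoint P M) (hPP' : Disjoint P P')
    (hMP' : Disjoint M P') (hQL : Disjoint Q L) (hQQ' : Disjoint Q Q') (hLQ' : Disjoint L Q')
    (hP : P.Nonempty) (hM : M.Nonempty) (hP' : P'.Nonempty)
    (hQ : Q.Nonempty) (hL : L.Nonempty) (hQ' : Q'.Nonempty) :
    ∃ θ, IsRep (P ∪ M ∪ P') (Q ∪ L ∪ Q') C θ ∧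
      ∀ p ∈ [(P, Q', Q ∪ C), (P, Q, M ∪ C), (M, Q', P ∪ P' ∪ Q ∪ L ∪ C),
        (P', Q, P ∪ M ∪ L ∪ C), (P, L, Q ∪ Q' ∪ C)], ∃ x y Γ, θ x y Γ ≠ 0 ∧
          x ∈ p.1 ∧ y ∈ p.2.1 ∧ p.2.2 ⊆ Γ ∧ Γ ⊆ p.1 ∪ p.2.1 ∪ p.2.2 ∧ x ∉ Γ ∧ y ∉ Γ := by
  have hBA := hAB.symm
  simp only [disjoint_union_left, disjoint_union_right] at hAB hAC hBC hBA
  have hd : ∀ X Y Z : Finset α, Disjoint X Y ∧ Disjoint X Z ∧ Disjoint Y Z →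
      ∃ θ, IsRep X Y Z θ := fun X Y Z h => exists_isRep h.1 h.2.1 h.2.2
  have d₁ : Disjoint M Q ∧ Disjoint M C ∧ Disjoint Q C := by tauto
  have d₂ : Disjoint P' L ∧ Disjoint P' (P ∪ M ∪ C) ∧ Disjoint L (P ∪ M ∪ C) := by
    simp only [disjoint_union_right, hPP'.symm, hMP'.symm, hAB, hAC, hBC, hBA, and_self]
  have d₃ : Disjoint M Q' ∧ Disjoint M (P ∪ P' ∪ Q ∪ L ∪ C) ∧
      Disjoint Q' (P ∪ P' ∪ Q ∪ L ∪ C) := by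
    simp only [disjoint_union_right, hPM.symm, hMP', hQQ'.symm, hLQ'.symm, hAB, hAC, hBC, hBA,
      and_self]
  have d₄ : Disjoint P L ∧ Disjoint P (Q ∪ Q' ∪ C) ∧ Disjoint L (Q ∪ Q' ∪ C) := by
    simp only [disjoint_union_right, hQL.symm, hLQ', hAB, hAC, hBC, and_self]
  have d₅ : Disjoint M L ∧ Disjoint M (P ∪ Q ∪ C) ∧ Disjoint L (P ∪ Q ∪ C) := by
    simp only [disjoint_union_right, hPM.symm, hQL.symm, hAB, hAC, hBC, hBA, and_self]
  have d₆ : Disjoint P Q ∧ Disjoint P (M ∪ C) ∧ Disjoint Q (M ∪ C) := by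
    simp only [disjoint_union_right, hPM, hAB, hAC, hBC, hBA, and_self]
  have d₇ : Disjoint P' Q ∧ Disjoint P' (P ∪ M ∪ L ∪ C) ∧ Disjoint Q (P ∪ M ∪ L ∪ C) := by
    simp only [disjoint_union_right, hPP'.symm, hMP'.symm, hQL, hAB, hAC, hBC, hBA, and_self]
  have d₈ : Disjoint P' Q' ∧ Disjoint P' (P ∪ Q ∪ L ∪ C) ∧ Disjoint Q' (P ∪ Q ∪ L ∪ C) := by
    simp only [disjoint_union_right, hPP'.symm, hQQ'.symm, hLQ'.symm, hAB, hAC, hBC, hBA,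
      and_self]
  have d₉ : Disjoint P Q' ∧ Disjoint P (Q ∪ C) ∧ Disjoint Q' (Q ∪ C) := by
    simp only [disjoint_union_right, hQQ'.symm, hAB, hAC, hBC, and_self]
  obtain ⟨θ₁, h₁⟩ := hd _ _ _ d₁
  obtain ⟨θ₂, h₂⟩ := hd _ _ _ d₂
  obtain ⟨θ₃, h₃⟩ := hd _ _ _ d₃
  obtain ⟨θ₄, h₄⟩ := hd _ _ _ d₄
  obtain ⟨θ₅, h₅⟩ := hd _ _ _ d₅
  obtain ⟨θ₆, h₆⟩ := hd _ _ _ d₆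
  obtain ⟨θ₇, h₇⟩ := hd _ _ _ d₇
  obtain ⟨θ₈, h₈⟩ := hd _ _ _ d₈
  obtain ⟨θ₉, h₉⟩ := hd _ _ _ d₉
  refine ⟨θ₁ + θ₂ + θ₃ + θ₄ + θ₅ + θ₆ + θ₇ + θ₈ + θ₉,
    (isRep_iff_pairing subset_rfl).2 ⟨?_, fun h => ?_⟩, ?_⟩
  · refine .add (.add (.add (.add (.add (.add (.add (.add (h₁.suppIn.mono ?_ ?_ ?_ ?_)
      (h₂.suppIn.mono ?_ ?_ ?_ ?_)) (h₃.suppIn.mono ?_ ?_ ?_ ?_)) (h₄.suppIn.mono ?_ ?_ ?_ ?_))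
      (h₅.suppIn.mono ?_ ?_ ?_ ?_)) (h₆.suppIn.mono ?_ ?_ ?_ ?_)) (h₇.suppIn.mono ?_ ?_ ?_ ?_))
      (h₈.suppIn.mono ?_ ?_ ?_ ?_)) (h₉.suppIn.mono ?_ ?_ ?_ ?_)
    all_goals
      clear * -
      grind
  · simp only [pairing_add]
    rw [secondDiff_pinwheel, h₁.secondDiff_eq, h₂.secondDiff_eq, h₃.secondDiff_eq,
      h₄.secondDiff_eq, h₅.secondDiff_eq, h₆.secondDiff_eq, h₇.secondDiff_eq, h₈.secondDiff_eq,
      h₉.secondDiff_eq]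
    all_goals
      clear * -
      grind
  · have hcell : ∀ {X Y Z : Finset α} {φ : α → α → Finset α → ℕ}, IsRep X Y Z φ →
        (Disjoint X Y ∧ Disjoint X Z ∧ Disjoint Y Z) → X.Nonempty → Y.Nonempty →
        ∃ x y Γ, φ x y Γ ≠ 0 ∧ x ∈ X ∧ y ∈ Y ∧ Z ⊆ Γ ∧ Γ ⊆ X ∪ Y ∪ Z ∧ x ∉ Γ ∧ y ∉ Γ := by
      intro X Y Z φ hr hd hX hY
      obtain ⟨x, y, Γ, hne⟩ := hr.exists_ne_zero hd.2.1 hd.2.2 hX hY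
      exact ⟨x, y, Γ, hne, hr.1 x y Γ hne⟩
    simp only [List.forall_mem_cons, List.not_mem_nil, false_imp_iff, implies_true, and_true,
      Pi.add_apply]
    refine ⟨?_, ?_, ?_, ?_, ?_⟩
    · exact (hcell h₉ d₉ hP hQ').imp fun x => .imp fun y => .imp fun Γ => .imp_left (by omega)
    · exact (hcell h₆ d₆ hP hQ).imp fun x => .imp fun y => .imp fun Γ => .imp_left (by omega)
    · exact (hcell h₃ d₃ hM hQ').imp fun x => .imp fun y => .imp fun Γ => .imp_left (by omega)
    · exact (hcell h₇ d₇ hP' hQ).imp fun x => .imp fun y => .imp fun Γ => .imp_left (by omega)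
    · exact (hcell h₄ d₄ hP hL).imp fun x => .imp fun y => .imp fun Γ => .imp_left (by omega)

/-- The pinwheel representation admits no cut when both sides have at least three elements. -/
theorem exists_isRep_not_sigmaDecomp (hAB : Disjoint A B) (hAC : Disjoint A C)
    (hBC : Disjoint B C) (hA : 3 ≤ A.card) (hB : 3 ≤ B.card) :
    ∃ θ, IsRep A B C θ ∧ ¬ SigmaDecomp A B C θ := by
  have hsplit : ∀ S : Finset α, 3 ≤ S.card → ∃ (s s' : α) (M : Finset α),
      S = {s} ∪ M ∪ {s'} ∧ s ≠ s' ∧ s ∉ M ∧ s' ∉ M ∧ M.Nonempty := by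
    intro S hS
    obtain ⟨s, hs⟩ : S.Nonempty := card_pos.1 (by omega)
    have h1 := card_erase_of_mem hs
    obtain ⟨s', hs'⟩ : (S.erase s).Nonempty := card_pos.1 (by omega)
    have h2 := card_erase_of_mem hs'
    exact ⟨s, s', (S.erase s).erase s', by grind, by grind, by grind, by grind,
      card_pos.1 (by omega)⟩
  have hA1 : A.card ≠ 1 := by omega
  obtain ⟨a, a', M, rfl, haa', haM, ha'M, hM⟩ := hsplit A hA
  obtain ⟨b, b', L, rfl, hbb', hbL, hb'L, hL⟩ := hsplit B hB
  obtain ⟨θ, hr, hcell⟩ := exists_isRep_pinwheel hAB hAC hBC (by simpa) (by simpa) (by simpa)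
    (by simpa) (by simpa) (by simpa) (singleton_nonempty a) hM (singleton_nonempty a')
    (singleton_nonempty b) hL (singleton_nonempty b')
  clear hsplit hA hB
  refine ⟨θ, hr, fun hd => ?_⟩
  simp only [List.forall_mem_cons, List.not_mem_nil, false_imp_iff, implies_true, and_true]
    at hcell
  obtain ⟨⟨x₁, y₁, Γ₁, n₁, s₁⟩, ⟨x₂, y₂, Γ₂, n₂, s₂⟩, ⟨x₃, y₃, Γ₃, n₃, s₃⟩,
    ⟨x₄, y₄, Γ₄, n₄, s₄⟩, ⟨x₅, y₅, Γ₅, n₅, s₅⟩⟩ := hcell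
  have hzA : ∀ A₀, ∀ z ∈ {a} ∪ M ∪ {a'}, z ∈ A₀ ∪ ({b} ∪ L ∪ {b'}) ∪ C → z ∈ A₀ :=
    fun A₀ z hz h => (mem_union.1 ((mem_union.1 h).resolve_right
      (Finset.disjoint_left.1 hAC hz))).resolve_right (Finset.disjoint_left.1 hAB hz)
  have hzB : ∀ B₀, ∀ z ∈ {b} ∪ L ∪ {b'}, z ∈ {a} ∪ M ∪ {a'} ∪ B₀ ∪ C → z ∈ B₀ :=
    fun B₀ z hz h => (mem_union.1 ((mem_union.1 h).resolve_right
      (Finset.disjoint_left.1 hBC hz))).resolve_left (Finset.disjoint_right.1 hAB hz)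
  simp only [union_subset_iff, singleton_subset_iff, mem_singleton] at s₁ s₂ s₃ s₄ s₅
  rcases hd.exists_cut hA1 with ⟨A₀, hsub, ⟨z, hz⟩, hne, hcut⟩ | ⟨B₀, hsub, ⟨z, hz⟩, hne, hcut⟩
  · have ha : a ∈ A₀ := by
      rcases hcut _ _ _ n₁ with h | h
      · have hΓ : {a} ∪ {b'} ∪ ({b} ∪ C) ⊆ {a} ∪ ({b} ∪ L ∪ {b'}) ∪ C := by
          clear * -
          grind
        exact mem_singleton.1 (hzA {a} z (hsub hz) (hΓ (s₁.2.2.2.1 (h hz)))) ▸ hz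
      · exact s₁.1 ▸ h.1
    have hMA : M ⊆ A₀ := fun m hm => hzA A₀ m (by simp [hm])
      (((hcut _ _ _ n₂).resolve_left fun h => s₂.2.2.2.2.1 (s₂.1 ▸ h ha)).2 (s₂.2.2.1.1 hm))
    have ha' : a' ∈ A₀ := hzA A₀ a' (by simp)
      (((hcut _ _ _ n₃).resolve_left fun h => s₃.2.2.2.2.1 (h (hMA s₃.1))).2 s₃.2.2.1.1.1.1.2)
    exact hne (hsub.antisymm (union_subset (union_subset (singleton_subset_iff.2 ha) hMA)
      (singleton_subset_iff.2 ha')))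
  · have hb : b ∈ B₀ := by
      rcases hcut _ _ _ n₂ with h | h
      · have hΓ : {a} ∪ {b} ∪ (M ∪ C) ⊆ {a} ∪ M ∪ {a'} ∪ {b} ∪ C := by
          clear * -
          grind
        exact mem_singleton.1 (hzB {b} z (hsub hz) (hΓ (s₂.2.2.2.1 (h hz)))) ▸ hz
      · exact s₂.2.1 ▸ h.1
    have hLB : L ⊆ B₀ := fun m hm => hzB B₀ m (by simp [hm])
      (((hcut _ _ _ n₄).resolve_left fun h => s₄.2.2.2.2.2 (s₄.2.1 ▸ h hb)).2 (s₄.2.2.1.1.2 hm))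
    have hb' : b' ∈ B₀ := hzB B₀ b' (by simp)
      (((hcut _ _ _ n₅).resolve_left fun h => s₅.2.2.2.2.2 (h (hLB s₅.2.1))).2 s₅.2.2.1.1.2)
    exact hne (hsub.antisymm (union_subset (union_subset (singleton_subset_iff.2 hb) hLB)
      (singleton_subset_iff.2 hb')))

end Pinwheel

theorem stmt10 {α : Type*} [DecidableEq α] (A B C : Finset α)
    (hAB : Disjoint A B) (hAC : Disjoint A C) (hBC : Disjoint B C)
    (hAne : A.Nonempty) (hBne : B.Nonempty) :
    (∀ θ : α → α → Finset α → ℕ, IsRep A B C θ → SigmaDecomp A B C θ) ↔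
      (A.card ≤ 2 ∨ B.card ≤ 2) := by
  constructor
  · intro h
    by_contra! hn
    obtain ⟨θ, hr, hd⟩ := exists_isRep_not_sigmaDecomp hAB hAC hBC hn.1 hn.2
    exact hd (h θ hr)
  · rintro (hA | hB) θ hr
    · exact (hr.swap.sigmaDecomp_of_card_le_two _ le_rfl hAB.symm hBC hAC hBne hAne hA).swap
    · exact hr.sigmaDecomp_of_card_le_two _ le_rfl hAB hAC hBC hAne hBne hB
end

section
/- Let N be a finite set containing six distinct elements a1, a2, a3, b1, b2, b3. Then u_{⟨{a1,a2,a3},{b1,b2,b3}|∅⟩} = u_{⟨a1,b1|∅⟩} + u_{⟨a2,b1|{a1}⟩} + u_{⟨a3,b3|{a1,a2}⟩} + u_{⟨a2,b2|{b1}⟩} + u_{⟨a1,b3|{a2,b1}⟩} + u_{⟨a3,b1|{a1,a2,b3}⟩} + u_{⟨a2,b3|{b1,b2}⟩} + u_{⟨a3,b2|{a2,b1,b3}⟩} + u_{⟨a1,b2|{a2,a3,b1,b3}⟩}, and the corresponding representation of u_{⟨{a1,a2,a3},{b1,b2,b3}|∅⟩} is σ-indecomposable (not σ-decomposable). -/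
open Finset

/-- A σ-decomposable representation is elementary, or separable along a proper nonempty `A₀ ⊆ A`,
or separable along a proper nonempty `B₀ ⊆ B`. In the second case every elementary imset in use has
its first argument in `A₀` and its conditioning set inside `A₀ ∪ B ∪ C`, or has its first argument
outside `A₀` and its conditioning set containing `A₀`; the third case is symmetric. -/
theorem SigmaDecomp.exists_separation {α : Type*} [DecidableEq α] {A B C : Finset α}
    {θ : α → α → Finset α → ℕ} (h : SigmaDecomp A B C θ) :
    (A.card = 1 ∧ B.card = 1) ∨
    (∃ A₀, A₀ ⊆ A ∧ A₀.Nonempty ∧ A₀ ≠ A ∧ ∀ x y Z, θ x y Z ≠ 0 →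
      (x ∈ A₀ ∧ Z ⊆ A₀ ∪ B ∪ C) ∨ (x ∉ A₀ ∧ A₀ ⊆ Z)) ∨
    (∃ B₀, B₀ ⊆ B ∧ B₀.Nonempty ∧ B₀ ≠ B ∧ ∀ x y Z, θ x y Z ≠ 0 →
      (y ∈ B₀ ∧ Z ⊆ A ∪ B₀ ∪ C) ∨ (y ∉ B₀ ∧ B₀ ⊆ Z)) := by
  cases h with
  | base hA hB _ => exact Or.inl ⟨hA, hB⟩
  | @sepA _ _ _ _ θ₁ θ₂ A₀ hsub hnon hne hadd h₁ h₂ _ _ =>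
    refine Or.inr (Or.inl ⟨A₀, hsub, hnon, hne, fun x y Z hz => ?_⟩)
    by_cases hx : θ₁ x y Z = 0
    · obtain ⟨hx, -, hZ, -⟩ := h₂.1 x y Z (by rw [hadd, hx] at hz; omega)
      exact Or.inr ⟨(mem_sdiff.1 hx).2, subset_union_left.trans hZ⟩
    · obtain ⟨hx, -, -, hZ, -⟩ := h₁.1 x y Z hx
      exact Or.inl ⟨hx, hZ⟩
  | @sepB _ _ _ _ θ₁ θ₂ B₀ hsub hnon hne hadd h₁ h₂ _ _ =>
    refine Or.inr (Or.inr ⟨B₀, hsub, hnon, hne, fun x y Z hz => ?_⟩)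
    by_cases hx : θ₁ x y Z = 0
    · obtain ⟨-, hy, hZ, -⟩ := h₂.1 x y Z (by rw [hadd, hx] at hz; omega)
      exact Or.inr ⟨(mem_sdiff.1 hy).2, subset_union_left.trans hZ⟩
    · obtain ⟨-, hy, -, hZ, -⟩ := h₁.1 x y Z hx
      exact Or.inl ⟨hy, hZ⟩

theorem stmt11 {α : Type*} [DecidableEq α] (N : Finset α) (a₁ a₂ a₃ b₁ b₂ b₃ : α)
    (ha₁ : a₁ ∈ N) (ha₂ : a₂ ∈ N) (ha₃ : a₃ ∈ N)
    (hb₁ : b₁ ∈ N) (hb₂ : b₂ ∈ N) (hb₃ : b₃ ∈ N)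
    (hnd : ([a₁, a₂, a₃, b₁, b₂, b₃] : List α).Nodup) :
    (∀ S : Finset α,
      uim {a₁, a₂, a₃} {b₁, b₂, b₃} (∅ : Finset α) S =
        uim {a₁} {b₁} ∅ S + uim {a₂} {b₁} {a₁} S + uim {a₃} {b₃} {a₁, a₂} S
          + uim {a₂} {b₂} {b₁} S + uim {a₁} {b₃} {a₂, b₁} S
          + uim {a₃} {b₁} {a₁, a₂, b₃} S + uim {a₂} {b₃} {b₁, b₂} S
          + uim {a₃} {b₂} {a₂, b₁, b₃} S + uim {a₁} {b₂} {a₂, a₃, b₁, b₃} S) ∧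
    ¬ SigmaDecomp {a₁, a₂, a₃} {b₁, b₂, b₃} (∅ : Finset α)
        (fun x y Z =>
          (if x = a₁ ∧ y = b₁ ∧ Z = (∅ : Finset α) then 1 else 0)
          + (if x = a₂ ∧ y = b₁ ∧ Z = {a₁} then 1 else 0)
          + (if x = a₃ ∧ y = b₃ ∧ Z = {a₁, a₂} then 1 else 0)
          + (if x = a₂ ∧ y = b₂ ∧ Z = {b₁} then 1 else 0)
          + (if x = a₁ ∧ y = b₃ ∧ Z = {a₂, b₁} then 1 else 0)
          + (if x = a₃ ∧ y = b₁ ∧ Z = {a₁, a₂, b₃} then 1 else 0)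
          + (if x = a₂ ∧ y = b₃ ∧ Z = {b₁, b₂} then 1 else 0)
          + (if x = a₃ ∧ y = b₂ ∧ Z = {a₂, b₁, b₃} then 1 else 0)
          + (if x = a₁ ∧ y = b₂ ∧ Z = {a₂, a₃, b₁, b₃} then 1 else 0)) := by
  simp only [List.nodup_cons, List.mem_cons, List.not_mem_nil, or_false, not_or] at hnd
  obtain ⟨⟨h12, h13, h14, h15, h16⟩, ⟨h23, h24, h25, h26⟩, ⟨h34, h35, h36⟩, ⟨h45, h46⟩, h56, -⟩ :=
    hnd
  refine ⟨fun S => ?_, fun h => ?_⟩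
  · simp only [uim, ← insert_empty_eq, insert_union, empty_union, union_empty, insert_comm]
    ring
  · rcases h.exists_separation with ⟨hA, -⟩ | ⟨A₀, hsub, hnon, hne, hsep⟩ | ⟨B₀, hsub, hnon, hne, hsep⟩
    · have hcard : ({a₁, a₂, a₃} : Finset α).card = 3 := card_eq_three.2
        ⟨a₁, a₂, a₃, h12, h13, h23, rfl⟩
      omega
    · have m₁ : a₁ ∈ A₀ := by
        rcases hsep a₁ b₁ ∅ (by simp) with ⟨hx, -⟩ | ⟨-, hZ⟩
        · exact hx
        · exact absurd (subset_empty.1 hZ) hnon.ne_empty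
      have m₂ : a₂ ∈ A₀ := by
        rcases hsep a₂ b₂ {b₁} (by simp) with ⟨hx, -⟩ | ⟨-, hZ⟩
        · exact hx
        · exact absurd (hZ m₁) (by simpa using h14)
      have m₃ : a₃ ∈ A₀ := by
        rcases hsep a₁ b₂ {a₂, a₃, b₁, b₃} (by simp) with ⟨-, hZ⟩ | ⟨hx, -⟩
        · have := @hZ a₃ (by simp)
          simpa [h34, h35, h36] using this
        · exact absurd m₁ hx
      exact hne (hsub.antisymm (by simp [insert_subset_iff, m₁, m₂, m₃]))
    · have m₁ : b₁ ∈ B₀ := by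
        rcases hsep a₁ b₁ ∅ (by simp) with ⟨hy, -⟩ | ⟨-, hZ⟩
        · exact hy
        · exact absurd (subset_empty.1 hZ) hnon.ne_empty
      have m₃ : b₃ ∈ B₀ := by
        rcases hsep a₃ b₃ {a₁, a₂} (by simp) with ⟨hy, -⟩ | ⟨-, hZ⟩
        · exact hy
        · exact absurd (hZ m₁) (by simp [Ne.symm h14, Ne.symm h24])
      have m₂ : b₂ ∈ B₀ := by
        rcases hsep a₂ b₃ {b₁, b₂} (by simp) with ⟨-, hZ⟩ | ⟨hy, -⟩
        · have := @hZ b₂ (by simp)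
          simpa [Ne.symm h15, Ne.symm h25, Ne.symm h35] using this
        · exact absurd m₃ hy
      exact hne (hsub.antisymm (by simp [insert_subset_iff, m₁, m₂, m₃]))
end

section
/- Let N be a finite set, A, B, C pairwise disjoint subsets of N with A, B nonempty, and let θ be a representation of u_{⟨A,B|C⟩} with terms u_θ(s,t). Then: (1) Γ(u_θ(0,0)) = C, and no term of θ has aΓ-, bΓ- or abΓ-value equal to C; (2) aΓ(u_θ(|A|−1,0)) = A∪C, and no term of θ has Γ-, bΓ- or abΓ-value equal to A∪C; (3) bΓ(u_θ(0,|B|−1)) = B∪C, and no term of θ has Γ-, aΓ- or abΓ-value equal to B∪C; (4) abΓ(u_θ(|A|−1,|B|−1)) = A∪B∪C, and no term of θ has Γ-, aΓ- or bΓ-value equal to A∪B∪C. -/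
open Finset

/-- A representation of `u_{⟨A,B|C⟩}` recorded through its terms
`u_θ(s,t) = u_{⟨a_{st}, b_{st} | Γ_{st}⟩}`, one from each class `E^{s,t}_{⟨A,B|C⟩}`
(i.e. with `|A ∩ Γ_{st}| = s`, `|B ∩ Γ_{st}| = t`) for `0 ≤ s ≤ |A|−1`, `0 ≤ t ≤ |B|−1`,
summing to `u_{⟨A,B|C⟩}`. -/
def IsTermRep {α : Type*} [DecidableEq α] (A B C : Finset α)
    (as bs : ℕ → ℕ → α) (Γs : ℕ → ℕ → Finset α) : Prop :=
  (∀ s t, s < A.card → t < B.card →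
      as s t ∈ A ∧ bs s t ∈ B ∧ C ⊆ Γs s t ∧ Γs s t ⊆ A ∪ B ∪ C ∧
      as s t ∉ Γs s t ∧ bs s t ∉ Γs s t ∧
      (A ∩ Γs s t).card = s ∧ (B ∩ Γs s t).card = t) ∧
  ∀ S : Finset α, uim A B C S =
      ∑ s ∈ Finset.range A.card, ∑ t ∈ Finset.range B.card,
        uim {as s t} {bs s t} (Γs s t) S

theorem uim_comm {α : Type*} [DecidableEq α] (A B C S : Finset α) :
    uim A B C S = uim B A C S := by
  unfold uim
  rw [Finset.union_comm A B]
  ring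

theorem uim_union_left {α : Type*} [DecidableEq α] {A B C : Finset α}
    (hAB : Disjoint A B) (hAC : Disjoint A C) (hBC : Disjoint B C)
    (hA : A.Nonempty) (hB : B.Nonempty) : uim A B C (A ∪ C) = -1 := by
  obtain ⟨a, ha⟩ := hA
  obtain ⟨b, hb⟩ := hB
  have haB := Finset.disjoint_left.mp hAB ha
  have haC := Finset.disjoint_left.mp hAC ha
  have hbA := Finset.disjoint_right.mp hAB hb
  have hbC := Finset.disjoint_left.mp hBC hb
  have h₁ : A ∪ C ≠ A ∪ B ∪ C := fun h => by
    have h' := congrArg (b ∈ ·) h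
    grind
  have h₂ : A ∪ C ≠ C := fun h => by
    have h' := congrArg (a ∈ ·) h
    grind
  have h₃ : A ∪ C ≠ B ∪ C := fun h => by
    have h' := congrArg (a ∈ ·) h
    grind
  simp only [uim, if_neg h₁, if_neg h₂, if_neg h₃]
  simp

/-- Where an elementary imset is negative, the argument is one of the two middle sets. -/
theorem eq_insert_of_uim_singleton_neg {α : Type*} [DecidableEq α] {a b : α} {G S : Finset α}
    (h : uim {a} {b} G S < 0) : insert a G = S ∨ insert b G = S := by
  by_contra! hne
  have h₁ : ¬ S = {a} ∪ G := fun h => hne.1 (by rw [h, Finset.insert_eq])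
  have h₂ : ¬ S = {b} ∪ G := fun h => hne.2 (by rw [h, Finset.insert_eq])
  simp only [uim, if_neg h₁, if_neg h₂] at h
  split_ifs at h <;> omega

/-- Exchanging the roles of `A` and `B` turns a representation into a representation. -/
theorem IsTermRep.swap {α : Type*} [DecidableEq α] {A B C : Finset α}
    {as bs : ℕ → ℕ → α} {Γs : ℕ → ℕ → Finset α} (hθ : IsTermRep A B C as bs Γs) :
    IsTermRep B A C (fun s t => bs t s) (fun s t => as t s) (fun s t => Γs t s) := by
  refine ⟨fun s t hs ht => ?_, fun S => ?_⟩
  · obtain ⟨ha, hb, hC, hsub, haG, hbG, hcA, hcB⟩ := hθ.1 t s ht hs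
    exact ⟨hb, ha, hC, by rwa [Finset.union_comm B A], hbG, haG, hcB, hcA⟩
  · rw [uim_comm, hθ.2 S, Finset.sum_comm]
    exact Finset.sum_congr rfl fun _ _ => Finset.sum_congr rfl fun _ _ => uim_comm _ _ _ _

theorem IsTermRep.insert_left_eq_union {α : Type*} [DecidableEq α] {A B C : Finset α}
    {as bs : ℕ → ℕ → α} {Γs : ℕ → ℕ → Finset α}
    (hAB : Disjoint A B) (hAC : Disjoint A C) (hBC : Disjoint B C)
    (hA : A.Nonempty) (hB : B.Nonempty) (hθ : IsTermRep A B C as bs Γs) :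
    insert (as (A.card - 1) 0) (Γs (A.card - 1) 0) = A ∪ C := by
  have hneg : ∑ s ∈ Finset.range A.card, ∑ t ∈ Finset.range B.card,
      uim {as s t} {bs s t} (Γs s t) (A ∪ C) < 0 := by
    rw [← hθ.2, uim_union_left hAB hAC hBC hA hB]
    norm_num
  obtain ⟨s, t, hs, ht, hst⟩ : ∃ s t, s < A.card ∧ t < B.card ∧
      uim {as s t} {bs s t} (Γs s t) (A ∪ C) < 0 := by
    by_contra! h
    exact hneg.not_ge <| Finset.sum_nonneg fun s hs => Finset.sum_nonneg fun t ht =>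
      h s t (Finset.mem_range.mp hs) (Finset.mem_range.mp ht)
  obtain ⟨ha, hb, -, -, haG, -, hcA, hcB⟩ := hθ.1 s t hs ht
  have hbA := Finset.disjoint_right.mp hAB hb
  have hbC := Finset.disjoint_left.mp hBC hb
  rcases eq_insert_of_uim_singleton_neg hst with h | h
  · have hAG : A ∩ Γs s t = A.erase (as s t) := by
      ext x
      have hx := congrArg (x ∈ ·) h
      grind
    have hBG : B ∩ Γs s t = ∅ := by
      ext x
      have hx := congrArg (x ∈ ·) h
      have h₁ : x ∈ A → x ∉ B := fun hxA => Finset.disjoint_left.mp hAB hxA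
      have h₂ : x ∈ B → x ∉ C := fun hxB => Finset.disjoint_left.mp hBC hxB
      grind
    rw [hAG, Finset.card_erase_of_mem ha] at hcA
    rw [hBG, Finset.card_empty] at hcB
    rwa [hcA, hcB]
  · exact absurd (h ▸ Finset.mem_insert_self _ _ : bs s t ∈ A ∪ C) (by simp [hbA, hbC])

theorem IsTermRep.base_eq {α : Type*} [DecidableEq α] {A B C : Finset α}
    {as bs : ℕ → ℕ → α} {Γs : ℕ → ℕ → Finset α}
    (hA : A.Nonempty) (hB : B.Nonempty) (hθ : IsTermRep A B C as bs Γs) : Γs 0 0 = C := by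
  obtain ⟨-, -, hC, hsub, -, -, hcA, hcB⟩ := hθ.1 0 0 hA.card_pos hB.card_pos
  rw [Finset.card_eq_zero] at hcA hcB
  ext x
  have h₁ := congrArg (x ∈ ·) hcA
  have h₂ := congrArg (x ∈ ·) hcB
  have h₃ := @hC x
  have h₄ := @hsub x
  grind

theorem insert_inter_eq_of_card {α : Type*} [DecidableEq α] {A G : Finset α} {a : α}
    (ha : a ∈ A) (haG : a ∉ G) (h : (A ∩ G).card = A.card - 1) : insert a (A ∩ G) = A := by
  refine Finset.eq_of_subset_of_card_le
    (Finset.insert_subset ha Finset.inter_subset_left) ?_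
  rw [Finset.card_insert_of_notMem (by simp [haG]), h]
  omega

theorem IsTermRep.top_eq {α : Type*} [DecidableEq α] {A B C : Finset α}
    {as bs : ℕ → ℕ → α} {Γs : ℕ → ℕ → Finset α}
    (hA : A.Nonempty) (hB : B.Nonempty) (hθ : IsTermRep A B C as bs Γs) :
    insert (as (A.card - 1) (B.card - 1))
      (insert (bs (A.card - 1) (B.card - 1)) (Γs (A.card - 1) (B.card - 1))) = A ∪ B ∪ C := by
  obtain ⟨ha, hb, hC, hsub, haG, hbG, hcA, hcB⟩ := hθ.1 (A.card - 1) (B.card - 1)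
    (Nat.sub_one_lt hA.card_ne_zero) (Nat.sub_one_lt hB.card_ne_zero)
  have hA' := insert_inter_eq_of_card ha haG hcA
  have hB' := insert_inter_eq_of_card hb hbG hcB
  ext x
  have h₁ := congrArg (x ∈ ·) hA'
  have h₂ := congrArg (x ∈ ·) hB'
  have h₃ := @hC x
  have h₄ := @hsub x
  grind

theorem stmt14 {α : Type*} [DecidableEq α] (A B C : Finset α)
    (as bs : ℕ → ℕ → α) (Γs : ℕ → ℕ → Finset α)
    (hAB : Disjoint A B) (hAC : Disjoint A C) (hBC : Disjoint B C)
    (hAne : A.Nonempty) (hBne : B.Nonempty)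
    (hθ : IsTermRep A B C as bs Γs) :
    (Γs 0 0 = C ∧
      ∀ s t, s < A.card → t < B.card →
        insert (as s t) (Γs s t) ≠ C ∧ insert (bs s t) (Γs s t) ≠ C ∧
        insert (as s t) (insert (bs s t) (Γs s t)) ≠ C) ∧
    (insert (as (A.card - 1) 0) (Γs (A.card - 1) 0) = A ∪ C ∧
      ∀ s t, s < A.card → t < B.card →
        Γs s t ≠ A ∪ C ∧ insert (bs s t) (Γs s t) ≠ A ∪ C ∧
        insert (as s t) (insert (bs s t) (Γs s t)) ≠ A ∪ C) ∧
    (insert (bs 0 (B.card - 1)) (Γs 0 (B.card - 1)) = B ∪ C ∧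
      ∀ s t, s < A.card → t < B.card →
        Γs s t ≠ B ∪ C ∧ insert (as s t) (Γs s t) ≠ B ∪ C ∧
        insert (as s t) (insert (bs s t) (Γs s t)) ≠ B ∪ C) ∧
    (insert (as (A.card - 1) (B.card - 1))
        (insert (bs (A.card - 1) (B.card - 1)) (Γs (A.card - 1) (B.card - 1)))
        = A ∪ B ∪ C ∧
      ∀ s t, s < A.card → t < B.card →
        Γs s t ≠ A ∪ B ∪ C ∧ insert (as s t) (Γs s t) ≠ A ∪ B ∪ C ∧
        insert (bs s t) (Γs s t) ≠ A ∪ B ∪ C) := by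
  have hmem : ∀ s t, s < A.card → t < B.card →
      (as s t ∈ A ∧ as s t ∉ B ∧ as s t ∉ C ∧ as s t ∉ Γs s t) ∧
      (bs s t ∈ B ∧ bs s t ∉ A ∧ bs s t ∉ C ∧ bs s t ∉ Γs s t) ∧ as s t ≠ bs s t := by
    intro s t hs ht
    obtain ⟨ha, hb, -, -, haG, hbG, -, -⟩ := hθ.1 s t hs ht
    have haB := Finset.disjoint_left.mp hAB ha
    exact ⟨⟨ha, haB, Finset.disjoint_left.mp hAC ha, haG⟩,
      ⟨hb, Finset.disjoint_right.mp hAB hb, Finset.disjoint_left.mp hBC hb, hbG⟩,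
      fun h => haB (h ▸ hb)⟩
  refine ⟨⟨hθ.base_eq hAne hBne, fun s t hs ht => ?_⟩,
    ⟨hθ.insert_left_eq_union hAB hAC hBC hAne hBne, fun s t hs ht => ?_⟩,
    ⟨hθ.swap.insert_left_eq_union hAB.symm hBC hAC hBne hAne, fun s t hs ht => ?_⟩,
    ⟨hθ.top_eq hAne hBne, fun s t hs ht => ?_⟩⟩ <;>
  · have := hmem s t hs ht
    refine ⟨fun h => ?_, fun h => ?_, fun h => ?_⟩ <;>
    · have h₁ := congrArg (as s t ∈ ·) h
      have h₂ := congrArg (bs s t ∈ ·) h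
      grind
end

section
/- Let N be a finite set, A, B, C pairwise disjoint subsets of N with A, B nonempty, and let θ be a representation of u_{⟨A,B|C⟩} with terms u_θ(s,t). Then: (1) for 0 ≤ s ≤ |A|−2, Γ(u_θ(s+1,0)) = aΓ(u_θ(s,0)), and no term of θ has bΓ- or abΓ-value equal to aΓ(u_θ(s,0)); (2) for 0 ≤ t ≤ |B|−2, Γ(u_θ(0,t+1)) = bΓ(u_θ(0,t)), and no term of θ has aΓ- or abΓ-value equal to bΓ(u_θ(0,t)); (3) for 0 ≤ s ≤ |A|−2, bΓ(u_θ(s+1,|B|−1)) = abΓ(u_θ(s,|B|−1)), and no term of θ has Γ- or aΓ-value equal to abΓ(u_θ(s,|B|−1)); (4) for 0 ≤ t ≤ |B|−2, aΓ(u_θ(|A|−1,t+1)) = abΓ(u_θ(|A|−1,t)), and no term of θ has Γ- or bΓ-value equal to abΓ(u_θ(|A|−1,t)). -/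
open Finset

section

variable {α : Type*} [DecidableEq α]

theorem uim_swap (A B C : Finset α) : uim B A C = uim A B C := by
  funext S
  simp only [uim, union_comm B A]
  ring

theorem uim_singleton (a b : α) (Γ S : Finset α) :
    uim {a} {b} Γ S = (if S = insert a (insert b Γ) then 1 else 0) + (if S = Γ then 1 else 0)
      - (if S = insert a Γ then 1 else 0) - (if S = insert b Γ then 1 else 0) := by
  unfold uim
  rw [insert_eq a (insert b Γ), insert_eq b Γ, insert_eq a Γ, union_assoc]

theorem uim_eq_zero_of_card {A B C S : Finset α}
    (hAB : Disjoint A B) (hAC : Disjoint A C) (hA0 : 0 < #(A ∩ S)) (hA : #(A ∩ S) < #A) :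
    uim A B C S = 0 := by
  have h1 : S ≠ A ∪ B ∪ C := by
    rintro rfl
    rw [union_assoc, inter_eq_left.mpr subset_union_left] at hA
    exact hA.false
  have h2 : S ≠ C := by
    rintro rfl
    simp [disjoint_iff_inter_eq_empty.mp hAC] at hA0
  have h3 : S ≠ A ∪ C := by
    rintro rfl
    rw [inter_eq_left.mpr subset_union_left] at hA
    exact hA.false
  have h4 : S ≠ B ∪ C := by
    rintro rfl
    simp [disjoint_iff_inter_eq_empty.mp (disjoint_union_right.mpr ⟨hAB, hAC⟩)] at hA0
  simp only [uim, if_neg h1, if_neg h2, if_neg h3, if_neg h4, add_zero, sub_zero]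

theorem card_inter_insert_of_mem {A Γ : Finset α} {a : α} (ha : a ∈ A) (haΓ : a ∉ Γ) :
    #(A ∩ insert a Γ) = #(A ∩ Γ) + 1 := by
  rw [inter_insert_of_mem ha, card_insert_of_notMem (by simp [haΓ])]

namespace IsTermRep

variable {A B C : Finset α} {as bs : ℕ → ℕ → α} {Γs : ℕ → ℕ → Finset α}

theorem swap_s15 (h : IsTermRep A B C as bs Γs) :
    IsTermRep B A C (fun t s => bs s t) (fun t s => as s t) (fun t s => Γs s t) := by
  refine ⟨fun t s ht hs => ?_, fun S => ?_⟩
  · obtain ⟨h1, h2, h3, h4, h5, h6, h7, h8⟩ := h.1 s t hs ht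
    exact ⟨h2, h1, h3, union_comm A B ▸ h4, h6, h5, h8, h7⟩
  · rw [uim_swap, h.2, sum_comm]
    simp only [uim_swap]

theorem card_inter_insert_left (h : IsTermRep A B C as bs Γs) {s t : ℕ}
    (hs : s < #A) (ht : t < #B) (hAB : Disjoint A B) :
    #(A ∩ insert (as s t) (Γs s t)) = s + 1 ∧ #(B ∩ insert (as s t) (Γs s t)) = t := by
  obtain ⟨ha, -, -, -, haΓ, -, hAΓ, hBΓ⟩ := h.1 s t hs ht
  rw [card_inter_insert_of_mem ha haΓ, hAΓ,
    inter_insert_of_notMem (disjoint_left.mp hAB ha)]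
  exact ⟨rfl, hBΓ⟩

theorem card_inter_insert_right (h : IsTermRep A B C as bs Γs) {s t : ℕ}
    (hs : s < #A) (ht : t < #B) (hAB : Disjoint A B) :
    #(A ∩ insert (bs s t) (Γs s t)) = s ∧ #(B ∩ insert (bs s t) (Γs s t)) = t + 1 :=
  (h.swap_s15.card_inter_insert_left ht hs hAB.symm).symm

theorem left_ne_right (h : IsTermRep A B C as bs Γs) {s t : ℕ} (hs : s < #A) (ht : t < #B)
    (hAB : Disjoint A B) : as s t ≠ bs s t := by
  obtain ⟨ha, hb, -⟩ := h.1 s t hs ht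
  exact fun e => disjoint_left.mp hAB ha (e ▸ hb)

theorem card_inter_insert_insert (h : IsTermRep A B C as bs Γs) {s t : ℕ}
    (hs : s < #A) (ht : t < #B) (hAB : Disjoint A B) :
    #(A ∩ insert (as s t) (insert (bs s t) (Γs s t))) = s + 1 ∧
      #(B ∩ insert (as s t) (insert (bs s t) (Γs s t))) = t + 1 := by
  obtain ⟨ha, -, -, -, haΓ, -⟩ := h.1 s t hs ht
  have hab := h.left_ne_right hs ht hAB
  obtain ⟨h1, h2⟩ := h.card_inter_insert_right hs ht hAB
  rw [card_inter_insert_of_mem ha (by simp [hab, haΓ]), h1,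
    inter_insert_of_notMem (disjoint_left.mp hAB ha)]
  exact ⟨rfl, h2⟩

theorem exists_eq_insert_left (h : IsTermRep A B C as bs Γs) {s t : ℕ} (hs : s < #A)
    (ht : t < #B) (hAB : Disjoint A B) (h0 : uim A B C (insert (as s t) (Γs s t)) = 0) :
    ∃ s' t', s' < #A ∧ t' < #B ∧ (insert (as s t) (Γs s t) = Γs s' t' ∨
      insert (as s t) (Γs s t) = insert (as s' t') (insert (bs s' t') (Γs s' t'))) := by
  obtain ⟨-, -, -, -, haΓ, hbΓ, -⟩ := h.1 s t hs ht
  have hab := h.left_ne_right hs ht hAB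
  have hne : uim {as s t} {bs s t} (Γs s t) (insert (as s t) (Γs s t)) ≠ 0 := by
    have h1 : insert (as s t) (Γs s t) ≠ insert (as s t) (insert (bs s t) (Γs s t)) := fun e => by
      have : bs s t ∈ insert (as s t) (Γs s t) := e ▸ by simp
      simp [hab.symm, hbΓ] at this
    have h2 : insert (as s t) (Γs s t) ≠ insert (bs s t) (Γs s t) := fun e => by
      have : as s t ∈ insert (bs s t) (Γs s t) := e ▸ by simp
      simp [hab, haΓ] at this
    simp [uim_singleton, h1, h2, haΓ]
  rw [h.2, ← sum_product'] at h0
  obtain ⟨p, hp, hpos⟩ := exists_pos_of_sum_zero_of_exists_nonzero _ h0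
    ⟨(s, t), by simp [hs, ht], hne⟩
  simp only [mem_product, mem_range] at hp
  refine ⟨p.1, p.2, hp.1, hp.2, ?_⟩
  by_contra! hne
  rw [uim_singleton, if_neg hne.1, if_neg hne.2] at hpos
  split_ifs at hpos <;> omega

theorem exists_eq_insert_insert (h : IsTermRep A B C as bs Γs) {s t : ℕ} (hs : s < #A)
    (ht : t < #B) (hAB : Disjoint A B)
    (h0 : uim A B C (insert (as s t) (insert (bs s t) (Γs s t))) = 0) :
    ∃ s' t', s' < #A ∧ t' < #B ∧
      (insert (as s t) (insert (bs s t) (Γs s t)) = insert (as s' t') (Γs s' t') ∨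
        insert (as s t) (insert (bs s t) (Γs s t)) = insert (bs s' t') (Γs s' t')) := by
  obtain ⟨-, -, -, -, haΓ, hbΓ, -⟩ := h.1 s t hs ht
  have hab := h.left_ne_right hs ht hAB
  have hne : uim {as s t} {bs s t} (Γs s t) (insert (as s t) (insert (bs s t) (Γs s t))) ≠ 0 := by
    have h1 : insert (as s t) (insert (bs s t) (Γs s t)) ≠ insert (as s t) (Γs s t) := fun e => by
      have : bs s t ∈ insert (as s t) (Γs s t) := e ▸ by simp
      simp [hab.symm, hbΓ] at this
    have h2 : insert (as s t) (insert (bs s t) (Γs s t)) ≠ Γs s t := fun e => haΓ (e ▸ by simp)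
    simp [uim_singleton, h1, h2, hab, haΓ]
  rw [h.2, ← sum_product', ← neg_eq_zero, ← sum_neg_distrib] at h0
  obtain ⟨p, hp, hpos⟩ := exists_pos_of_sum_zero_of_exists_nonzero _ h0
    ⟨(s, t), by simp [hs, ht], neg_ne_zero.mpr hne⟩
  simp only [mem_product, mem_range] at hp
  refine ⟨p.1, p.2, hp.1, hp.2, ?_⟩
  by_contra! hne
  rw [uim_singleton, if_neg hne.1, if_neg hne.2] at hpos
  split_ifs at hpos <;> omega

theorem lower_boundary (h : IsTermRep A B C as bs Γs) {s : ℕ} (hs : s + 1 < #A) (hB : 0 < #B)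
    (hAB : Disjoint A B) (hAC : Disjoint A C) :
    Γs (s + 1) 0 = insert (as s 0) (Γs s 0) ∧
      ∀ s' t', s' < #A → t' < #B →
        insert (bs s' t') (Γs s' t') ≠ insert (as s 0) (Γs s 0) ∧
        insert (as s' t') (insert (bs s' t') (Γs s' t')) ≠ insert (as s 0) (Γs s 0) := by
  have hs' : s < #A := by omega
  obtain ⟨cA, cB⟩ := h.card_inter_insert_left hs' hB hAB
  constructor
  · obtain ⟨s', t', hs₁, ht₁, e | e⟩ := h.exists_eq_insert_left hs' hB hAB
      (uim_eq_zero_of_card hAB hAC (by omega) (by omega))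
    · obtain ⟨-, -, -, -, -, -, hA, hB⟩ := h.1 s' t' hs₁ ht₁
      rw [← e] at hA hB
      obtain rfl : s' = s + 1 := by omega
      obtain rfl : t' = 0 := by omega
      exact e.symm
    · have := (h.card_inter_insert_insert hs₁ ht₁ hAB).2
      rw [← e] at this
      omega
  · intro s' t' hs₁ ht₁
    constructor <;> intro e
    · have := (h.card_inter_insert_right hs₁ ht₁ hAB).2
      rw [e] at this
      omega
    · have := (h.card_inter_insert_insert hs₁ ht₁ hAB).2
      rw [e] at this
      omega

theorem upper_boundary (h : IsTermRep A B C as bs Γs) {s : ℕ} (hs : s + 1 < #A) (hB : 0 < #B)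
    (hAB : Disjoint A B) (hAC : Disjoint A C) :
    insert (bs (s + 1) (#B - 1)) (Γs (s + 1) (#B - 1))
        = insert (as s (#B - 1)) (insert (bs s (#B - 1)) (Γs s (#B - 1))) ∧
      ∀ s' t', s' < #A → t' < #B →
        Γs s' t' ≠ insert (as s (#B - 1)) (insert (bs s (#B - 1)) (Γs s (#B - 1))) ∧
        insert (as s' t') (Γs s' t')
          ≠ insert (as s (#B - 1)) (insert (bs s (#B - 1)) (Γs s (#B - 1))) := by
  have hs' : s < #A := by omega
  have ht : #B - 1 < #B := by omega
  obtain ⟨cA, cB⟩ := h.card_inter_insert_insert hs' ht hAB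
  constructor
  · obtain ⟨s', t', hs₁, ht₁, e | e⟩ := h.exists_eq_insert_insert hs' ht hAB
      (uim_eq_zero_of_card hAB hAC (by omega) (by omega))
    · have := (h.card_inter_insert_left hs₁ ht₁ hAB).2
      rw [← e] at this
      omega
    · obtain ⟨hA, hB⟩ := h.card_inter_insert_right hs₁ ht₁ hAB
      rw [← e] at hA hB
      obtain rfl : s' = s + 1 := by omega
      obtain rfl : t' = #B - 1 := by omega
      exact e.symm
  · intro s' t' hs₁ ht₁
    constructor <;> intro e
    · obtain ⟨-, -, -, -, -, -, -, hB⟩ := h.1 s' t' hs₁ ht₁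
      rw [e] at hB
      omega
    · have := (h.card_inter_insert_left hs₁ ht₁ hAB).2
      rw [e] at this
      omega

end IsTermRep

end

theorem stmt15 {α : Type*} [DecidableEq α] (A B C : Finset α)
    (as bs : ℕ → ℕ → α) (Γs : ℕ → ℕ → Finset α)
    (hAB : Disjoint A B) (hAC : Disjoint A C) (hBC : Disjoint B C)
    (hAne : A.Nonempty) (hBne : B.Nonempty)
    (hθ : IsTermRep A B C as bs Γs) :
    (∀ s, s + 1 < A.card →
      Γs (s + 1) 0 = insert (as s 0) (Γs s 0) ∧
      ∀ s' t', s' < A.card → t' < B.card →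
        insert (bs s' t') (Γs s' t') ≠ insert (as s 0) (Γs s 0) ∧
        insert (as s' t') (insert (bs s' t') (Γs s' t')) ≠ insert (as s 0) (Γs s 0)) ∧
    (∀ t, t + 1 < B.card →
      Γs 0 (t + 1) = insert (bs 0 t) (Γs 0 t) ∧
      ∀ s' t', s' < A.card → t' < B.card →
        insert (as s' t') (Γs s' t') ≠ insert (bs 0 t) (Γs 0 t) ∧
        insert (as s' t') (insert (bs s' t') (Γs s' t')) ≠ insert (bs 0 t) (Γs 0 t)) ∧
    (∀ s, s + 1 < A.card →
      insert (bs (s + 1) (B.card - 1)) (Γs (s + 1) (B.card - 1))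
        = insert (as s (B.card - 1)) (insert (bs s (B.card - 1)) (Γs s (B.card - 1))) ∧
      ∀ s' t', s' < A.card → t' < B.card →
        Γs s' t' ≠ insert (as s (B.card - 1)) (insert (bs s (B.card - 1)) (Γs s (B.card - 1))) ∧
        insert (as s' t') (Γs s' t')
          ≠ insert (as s (B.card - 1)) (insert (bs s (B.card - 1)) (Γs s (B.card - 1)))) ∧
    (∀ t, t + 1 < B.card →
      insert (as (A.card - 1) (t + 1)) (Γs (A.card - 1) (t + 1))
        = insert (as (A.card - 1) t) (insert (bs (A.card - 1) t) (Γs (A.card - 1) t)) ∧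
      ∀ s' t', s' < A.card → t' < B.card →
        Γs s' t' ≠ insert (as (A.card - 1) t) (insert (bs (A.card - 1) t) (Γs (A.card - 1) t)) ∧
        insert (bs s' t') (Γs s' t')
          ≠ insert (as (A.card - 1) t) (insert (bs (A.card - 1) t) (Γs (A.card - 1) t))) := by
  have hA := hAne.card_pos
  have hB := hBne.card_pos
  refine ⟨fun s hs => hθ.lower_boundary hs hB hAB hAC,
    fun t ht => ?_, fun s hs => hθ.upper_boundary hs hB hAB hAC, fun t ht => ?_⟩
  · obtain ⟨h1, h2⟩ := hθ.swap_s15.lower_boundary ht hA hAB.symm hBC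
    refine ⟨h1, fun s' t' hs' ht' => ?_⟩
    rw [insert_comm (as s' t')]
    exact h2 t' s' ht' hs'
  · obtain ⟨h1, h2⟩ := hθ.swap_s15.upper_boundary ht hA hAB.symm hBC
    rw [insert_comm (as (#A - 1) t)]
    exact ⟨h1, fun s' t' hs' ht' => h2 t' s' ht' hs'⟩
end

section
/- Let N be a finite set, A, B, C pairwise disjoint subsets of N with A, B nonempty, and let θ be a representation of u_{⟨A,B|C⟩} with terms u_θ(s,t). Let Q be the set of all values of Γ, aΓ, bΓ, abΓ over the terms of θ, and let Q_i = Q ∖ ({C, A∪C, B∪C, A∪B∪C} ∪ Q_ll ∪ Q_lr ∪ Q_ul ∪ Q_ur), where Q_ll = {aΓ(u_θ(s,0)) : 0 ≤ s ≤ |A|−2}, Q_lr = {bΓ(u_θ(0,t)) : 0 ≤ t ≤ |B|−2}, Q_ul = {abΓ(u_θ(s,|B|−1)) : 0 ≤ s ≤ |A|−2}, Q_ur = {abΓ(u_θ(|A|−1,t)) : 0 ≤ t ≤ |B|−2}. Then for each Q ∈ Q_i, with s = |A∩Q| and t = |B∩Q|, exactly one of the following five configurations holds: (1) Q = Γ(u_θ(s,t))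 = aΓ(u_θ(s−1,t)) = bΓ(u_θ(s,t−1)) = abΓ(u_θ(s−1,t−1)); (2) Q = Γ(u_θ(s,t)) = bΓ(u_θ(s,t−1)) and Q is not an aΓ- or abΓ-value of any term; (3) Q = aΓ(u_θ(s−1,t)) = abΓ(u_θ(s−1,t−1)) and Q is not a Γ- or bΓ-value of any term; (4) Q = Γ(u_θ(s,t)) = aΓ(u_θ(s−1,t)) and Q is not a bΓ- or abΓ-value of any term; (5) Q = bΓ(u_θ(s,t−1)) = abΓ(u_θ(s−1,t−1)) and Q is not a Γ- or aΓ-value of any term. -/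
open Finset

/-- `aΓ(u_θ(s,t)) = {a_{st}} ∪ Γ_{st}`. -/
def aG {α : Type*} [DecidableEq α] (as : ℕ → ℕ → α) (Γs : ℕ → ℕ → Finset α)
    (s t : ℕ) : Finset α := insert (as s t) (Γs s t)

/-- `bΓ(u_θ(s,t)) = {b_{st}} ∪ Γ_{st}`. -/
def bG {α : Type*} [DecidableEq α] (bs : ℕ → ℕ → α) (Γs : ℕ → ℕ → Finset α)
    (s t : ℕ) : Finset α := insert (bs s t) (Γs s t)

/-- `abΓ(u_θ(s,t)) = {a_{st}, b_{st}} ∪ Γ_{st}`. -/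
def abG {α : Type*} [DecidableEq α] (as bs : ℕ → ℕ → α) (Γs : ℕ → ℕ → Finset α)
    (s t : ℕ) : Finset α := insert (as s t) (insert (bs s t) (Γs s t))

/-- `Q` belongs to the set `𝒬` of values of the four maps `Γ, aΓ, bΓ, abΓ`
over the terms of the representation. -/
def InQ {α : Type*} [DecidableEq α] (A B : Finset α) (as bs : ℕ → ℕ → α)
    (Γs : ℕ → ℕ → Finset α) (Q : Finset α) : Prop :=
  ∃ s t, s < A.card ∧ t < B.card ∧
    (Q = Γs s t ∨ Q = aG as Γs s t ∨ Q = bG bs Γs s t ∨ Q = abG as bs Γs s t)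

/-- A double sum of indicators supported on at most one index pair `(i, j)`. -/
theorem sum_range_indicator_eq (p : ℕ → ℕ → Prop) [∀ s t, Decidable (p s t)] (m n i j : ℕ)
    (h : ∀ s t, s < m → t < n → p s t → s = i ∧ t = j) :
    ∑ s ∈ Finset.range m, ∑ t ∈ Finset.range n, (if p s t then (1 : ℤ) else 0) =
      if i < m ∧ j < n ∧ p i j then 1 else 0 := by
  have key : ∀ s ∈ Finset.range m, ∀ t ∈ Finset.range n,
      (if p s t then (1 : ℤ) else 0) =
        if s = i then (if t = j then (if p i j then 1 else 0) else 0) else 0 := by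
    intro s hs t ht
    have := h s t (Finset.mem_range.1 hs) (Finset.mem_range.1 ht)
    by_cases hp : p s t
    · obtain ⟨rfl, rfl⟩ := this hp
      simp
    · rw [if_neg hp]
      split_ifs <;> simp_all
  rw [Finset.sum_congr rfl fun s hs => Finset.sum_congr rfl (key s hs)]
  by_cases hi : i < m <;> by_cases hj : j < n <;> simp [Finset.sum_ite_eq', hi, hj]

section Terms

variable {α : Type*} [DecidableEq α]

theorem card_inter_insert_of_notMem {A Γ : Finset α} {a : α} (ha : a ∈ A) (h : a ∉ Γ) :
    (A ∩ insert a Γ).card = (A ∩ Γ).card + 1 := by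
  rw [Finset.inter_insert_of_mem ha, Finset.card_insert_of_notMem (by simp [h])]

theorem uim_term (as bs : ℕ → ℕ → α) (Γs : ℕ → ℕ → Finset α) (s t : ℕ) (S : Finset α) :
    uim {as s t} {bs s t} (Γs s t) S =
      (if S = abG as bs Γs s t then 1 else 0) + (if S = Γs s t then 1 else 0)
        - (if S = aG as Γs s t then 1 else 0) - (if S = bG bs Γs s t then 1 else 0) := by
  have h : ({as s t} ∪ {bs s t} ∪ Γs s t : Finset α) = abG as bs Γs s t := by
    rw [Finset.union_assoc, ← Finset.insert_eq, ← Finset.insert_eq, abG]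
  rw [uim, h, ← Finset.insert_eq, ← Finset.insert_eq, aG, bG]

variable {A B C : Finset α} {as bs : ℕ → ℕ → α} {Γs : ℕ → ℕ → Finset α}

/-- The cardinalities of the intersections of `A` and `B` with the four sets of a term. -/
theorem IsTermRep.card_inter (hAB : Disjoint A B) (hθ : IsTermRep A B C as bs Γs)
    {s t : ℕ} (hs : s < A.card) (ht : t < B.card) :
    ((A ∩ Γs s t).card = s ∧ (B ∩ Γs s t).card = t) ∧
    ((A ∩ aG as Γs s t).card = s + 1 ∧ (B ∩ aG as Γs s t).card = t) ∧
    ((A ∩ bG bs Γs s t).card = s ∧ (B ∩ bG bs Γs s t).card = t + 1) ∧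
    ((A ∩ abG as bs Γs s t).card = s + 1 ∧ (B ∩ abG as bs Γs s t).card = t + 1) := by
  obtain ⟨ha, hb, -, -, haΓ, hbΓ, hA, hB⟩ := hθ.1 s t hs ht
  have haB : as s t ∉ B := Finset.disjoint_left.1 hAB ha
  have hbA : bs s t ∉ A := Finset.disjoint_right.1 hAB hb
  have hab : as s t ∉ insert (bs s t) (Γs s t) := by
    rw [Finset.mem_insert, not_or]
    exact ⟨fun h => hbA (h ▸ ha), haΓ⟩
  simp only [aG, bG, abG, Finset.inter_insert_of_notMem haB, Finset.inter_insert_of_notMem hbA,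
    card_inter_insert_of_notMem ha hab, card_inter_insert_of_notMem ha haΓ,
    card_inter_insert_of_notMem hb hbΓ, hA, hB, and_self]

end Terms

theorem stmt16 {α : Type*} [DecidableEq α] (A B C : Finset α)
    (as bs : ℕ → ℕ → α) (Γs : ℕ → ℕ → Finset α)
    (hAB : Disjoint A B) (hAC : Disjoint A C) (hBC : Disjoint B C)
    (hAne : A.Nonempty) (hBne : B.Nonempty)
    (hθ : IsTermRep A B C as bs Γs) :
    ∀ Q : Finset α,
      InQ A B as bs Γs Q →
      Q ≠ C → Q ≠ A ∪ C → Q ≠ B ∪ C → Q ≠ A ∪ B ∪ C →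
      (∀ s, s + 1 < A.card → Q ≠ aG as Γs s 0) →
      (∀ t, t + 1 < B.card → Q ≠ bG bs Γs 0 t) →
      (∀ s, s + 1 < A.card → Q ≠ abG as bs Γs s (B.card - 1)) →
      (∀ t, t + 1 < B.card → Q ≠ abG as bs Γs (A.card - 1) t) →
      (1 ≤ (A ∩ Q).card ∧ (A ∩ Q).card ≤ A.card - 1 ∧
        1 ≤ (B ∩ Q).card ∧ (B ∩ Q).card ≤ B.card - 1 ∧
        Q = Γs (A ∩ Q).card (B ∩ Q).card ∧
        Q = aG as Γs ((A ∩ Q).card - 1) (B ∩ Q).card ∧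
        Q = bG bs Γs (A ∩ Q).card ((B ∩ Q).card - 1) ∧
        Q = abG as bs Γs ((A ∩ Q).card - 1) ((B ∩ Q).card - 1)) ∨
      ((A ∩ Q).card < A.card ∧ 1 ≤ (B ∩ Q).card ∧ (B ∩ Q).card < B.card ∧
        Q = Γs (A ∩ Q).card (B ∩ Q).card ∧
        Q = bG bs Γs (A ∩ Q).card ((B ∩ Q).card - 1) ∧
        (∀ s' t', s' < A.card → t' < B.card →
          Q ≠ aG as Γs s' t' ∧ Q ≠ abG as bs Γs s' t')) ∨
      (1 ≤ (A ∩ Q).card ∧ (A ∩ Q).card ≤ A.card ∧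
        1 ≤ (B ∩ Q).card ∧ (B ∩ Q).card < B.card ∧
        Q = aG as Γs ((A ∩ Q).card - 1) (B ∩ Q).card ∧
        Q = abG as bs Γs ((A ∩ Q).card - 1) ((B ∩ Q).card - 1) ∧
        (∀ s' t', s' < A.card → t' < B.card →
          Q ≠ Γs s' t' ∧ Q ≠ bG bs Γs s' t')) ∨
      (1 ≤ (A ∩ Q).card ∧ (A ∩ Q).card < A.card ∧ (B ∩ Q).card < B.card ∧
        Q = Γs (A ∩ Q).card (B ∩ Q).card ∧
        Q = aG as Γs ((A ∩ Q).card - 1) (B ∩ Q).card ∧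
        (∀ s' t', s' < A.card → t' < B.card →
          Q ≠ bG bs Γs s' t' ∧ Q ≠ abG as bs Γs s' t')) ∨
      (1 ≤ (A ∩ Q).card ∧ (A ∩ Q).card < A.card ∧
        1 ≤ (B ∩ Q).card ∧ (B ∩ Q).card ≤ B.card ∧
        Q = bG bs Γs (A ∩ Q).card ((B ∩ Q).card - 1) ∧
        Q = abG as bs Γs ((A ∩ Q).card - 1) ((B ∩ Q).card - 1) ∧
        (∀ s' t', s' < A.card → t' < B.card →
          Q ≠ Γs s' t' ∧ Q ≠ aG as Γs s' t')) := by
  intro Q hQ hC hA hB hABC _ _ _ _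
  have hcard := fun s t hs ht => hθ.card_inter hAB (s := s) (t := t) hs ht
  have hΓ : ∀ s t, s < A.card → t < B.card → Q = Γs s t →
      (A ∩ Q).card = s ∧ (B ∩ Q).card = t := by
    intro s t hs ht h
    rw [h]
    exact (hcard s t hs ht).1
  have ha : ∀ s t, s < A.card → t < B.card → Q = aG as Γs s t →
      (A ∩ Q).card = s + 1 ∧ (B ∩ Q).card = t := by
    intro s t hs ht h
    rw [h]
    exact (hcard s t hs ht).2.1
  have hb : ∀ s t, s < A.card → t < B.card → Q = bG bs Γs s t →
      (A ∩ Q).card = s ∧ (B ∩ Q).card = t + 1 := by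
    intro s t hs ht h
    rw [h]
    exact (hcard s t hs ht).2.2.1
  have hab : ∀ s t, s < A.card → t < B.card → Q = abG as bs Γs s t →
      (A ∩ Q).card = s + 1 ∧ (B ∩ Q).card = t + 1 := by
    intro s t hs ht h
    rw [h]
    exact (hcard s t hs ht).2.2.2
  have hsum := hθ.2 Q
  simp only [uim_term, Finset.sum_sub_distrib, Finset.sum_add_distrib] at hsum
  rw [uim, if_neg hABC, if_neg hC, if_neg hA, if_neg hB] at hsum
  generalize (A ∩ Q).card = i at *
  generalize (B ∩ Q).card = j at *
  rw [sum_range_indicator_eq (fun s t => Q = abG as bs Γs s t) _ _ (i - 1) (j - 1)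
      (fun s t hs ht h => by have := hab s t hs ht h; omega),
    sum_range_indicator_eq (fun s t => Q = Γs s t) _ _ i j
      (fun s t hs ht h => by have := hΓ s t hs ht h; omega),
    sum_range_indicator_eq (fun s t => Q = aG as Γs s t) _ _ (i - 1) j
      (fun s t hs ht h => by have := ha s t hs ht h; omega),
    sum_range_indicator_eq (fun s t => Q = bG bs Γs s t) _ _ i (j - 1)
      (fun s t hs ht h => by have := hb s t hs ht h; omega)] at hsum
  have notΓ : ¬(i < A.card ∧ j < B.card ∧ Q = Γs i j) →
      ∀ s t, s < A.card → t < B.card → Q ≠ Γs s t := by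
    intro hn s t hs ht h
    obtain ⟨rfl, rfl⟩ := hΓ s t hs ht h
    exact hn ⟨hs, ht, h⟩
  have nota : ¬(i - 1 < A.card ∧ j < B.card ∧ Q = aG as Γs (i - 1) j) →
      ∀ s t, s < A.card → t < B.card → Q ≠ aG as Γs s t := by
    intro hn s t hs ht h
    obtain ⟨rfl, rfl⟩ := ha s t hs ht h
    exact hn ⟨hs, ht, h⟩
  have notb : ¬(i < A.card ∧ j - 1 < B.card ∧ Q = bG bs Γs i (j - 1)) →
      ∀ s t, s < A.card → t < B.card → Q ≠ bG bs Γs s t := by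
    intro hn s t hs ht h
    obtain ⟨rfl, rfl⟩ := hb s t hs ht h
    exact hn ⟨hs, ht, h⟩
  have notab : ¬(i - 1 < A.card ∧ j - 1 < B.card ∧ Q = abG as bs Γs (i - 1) (j - 1)) →
      ∀ s t, s < A.card → t < B.card → Q ≠ abG as bs Γs s t := by
    intro hn s t hs ht h
    obtain ⟨rfl, rfl⟩ := hab s t hs ht h
    exact hn ⟨hs, ht, h⟩
  have posa (h : i - 1 < A.card ∧ j < B.card ∧ Q = aG as Γs (i - 1) j) : 1 ≤ i := by
    have := ha _ _ h.1 h.2.1 h.2.2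
    omega
  have posb (h : i < A.card ∧ j - 1 < B.card ∧ Q = bG bs Γs i (j - 1)) : 1 ≤ j := by
    have := hb _ _ h.1 h.2.1 h.2.2
    omega
  have posab (h : i - 1 < A.card ∧ j - 1 < B.card ∧ Q = abG as bs Γs (i - 1) (j - 1)) :
      1 ≤ i ∧ 1 ≤ j := by
    have := hab _ _ h.1 h.2.1 h.2.2
    omega
  have hex : (i < A.card ∧ j < B.card ∧ Q = Γs i j) ∨
      (i - 1 < A.card ∧ j < B.card ∧ Q = aG as Γs (i - 1) j) ∨
      (i < A.card ∧ j - 1 < B.card ∧ Q = bG bs Γs i (j - 1)) ∨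
      (i - 1 < A.card ∧ j - 1 < B.card ∧ Q = abG as bs Γs (i - 1) (j - 1)) := by
    by_contra hn
    simp only [not_or] at hn
    obtain ⟨s, t, hs, ht, h | h | h | h⟩ := hQ
    · exact notΓ hn.1 s t hs ht h
    · exact nota hn.2.1 s t hs ht h
    · exact notb hn.2.2.1 s t hs ht h
    · exact notab hn.2.2.2 s t hs ht h
  clear hcard hΓ ha hb hab hQ
  by_cases pΓ : i < A.card ∧ j < B.card ∧ Q = Γs i j
  · by_cases pab : i - 1 < A.card ∧ j - 1 < B.card ∧ Q = abG as bs Γs (i - 1) (j - 1)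
    · have pa : i - 1 < A.card ∧ j < B.card ∧ Q = aG as Γs (i - 1) j := by
        by_contra hn
        rw [if_pos pΓ, if_pos pab, if_neg hn] at hsum
        split_ifs at hsum <;> omega
      have pb : i < A.card ∧ j - 1 < B.card ∧ Q = bG bs Γs i (j - 1) := by
        by_contra hn
        rw [if_pos pΓ, if_pos pab, if_pos pa, if_neg hn] at hsum
        omega
      exact Or.inl ⟨(posab pab).1, Nat.le_sub_one_of_lt pΓ.1, (posab pab).2,
        Nat.le_sub_one_of_lt pΓ.2.1, pΓ.2.2, pa.2.2, pb.2.2, pab.2.2⟩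
    · rw [if_pos pΓ, if_neg pab] at hsum
      by_cases pa : i - 1 < A.card ∧ j < B.card ∧ Q = aG as Γs (i - 1) j
      · have pb : ¬(i < A.card ∧ j - 1 < B.card ∧ Q = bG bs Γs i (j - 1)) := by
          intro hp
          rw [if_pos pa, if_pos hp] at hsum
          omega
        exact Or.inr <| Or.inr <| Or.inr <| Or.inl ⟨posa pa, pΓ.1, pΓ.2.1, pΓ.2.2, pa.2.2,
          fun s t hs ht => ⟨notb pb s t hs ht, notab pab s t hs ht⟩⟩
      · have pb : i < A.card ∧ j - 1 < B.card ∧ Q = bG bs Γs i (j - 1) := by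
          by_contra hn
          rw [if_neg pa, if_neg hn] at hsum
          omega
        exact Or.inr <| Or.inl ⟨pΓ.1, posb pb, pΓ.2.1, pΓ.2.2, pb.2.2,
          fun s t hs ht => ⟨nota pa s t hs ht, notab pab s t hs ht⟩⟩
  · have pab : i - 1 < A.card ∧ j - 1 < B.card ∧ Q = abG as bs Γs (i - 1) (j - 1) := by
      by_contra hn
      rw [if_neg pΓ, if_neg hn] at hsum
      rcases hex with h | h | h | h
      · exact pΓ h
      · rw [if_pos h] at hsum
        split_ifs at hsum <;> omega
      · rw [if_pos h] at hsum
        split_ifs at hsum <;> omega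
      · exact hn h
    rw [if_neg pΓ, if_pos pab] at hsum
    obtain ⟨hi, hj⟩ := posab pab
    by_cases pa : i - 1 < A.card ∧ j < B.card ∧ Q = aG as Γs (i - 1) j
    · have pb : ¬(i < A.card ∧ j - 1 < B.card ∧ Q = bG bs Γs i (j - 1)) := by
        intro hp
        rw [if_pos pa, if_pos hp] at hsum
        omega
      exact Or.inr <| Or.inr <| Or.inl ⟨hi, Nat.le_of_pred_lt pa.1, hj, pa.2.1, pa.2.2, pab.2.2,
        fun s t hs ht => ⟨notΓ pΓ s t hs ht, notb pb s t hs ht⟩⟩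
    · have pb : i < A.card ∧ j - 1 < B.card ∧ Q = bG bs Γs i (j - 1) := by
        by_contra hn
        rw [if_neg pa, if_neg hn] at hsum
        omega
      exact Or.inr <| Or.inr <| Or.inr <| Or.inr ⟨hi, pb.1, hj, Nat.le_of_pred_lt pb.2.1,
        pb.2.2, pab.2.2, fun s t hs ht => ⟨notΓ pΓ s t hs ht, nota pa s t hs ht⟩⟩
end
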